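/- arXiv:2503.06020 — 2 statements merged into one kernel-verified Lean document; each statement's English description precedes it below -/
import Mathlib

section
/- Theorem 3.3, convergence part (transition when δ = 1). Assume condition (f4) holds and δ = 1. Let (u,g,h) be a classical solution of the free boundary problem (c) with initial datum u₀ ∈ X(h₀) on [0,∞). Then the limits g_∞ := lim_{t→∞} g(t) and h_∞ := lim_{t→∞} h(t) exist and are finite, and sup_{x ∈ [g(t),h(t)]} |u(t,x) − 1| → 0 as t → ∞. -/
open Set Filter

/-- A function `f` is of Allee type `(f_A)` with distinguished zero `θ ∈ [0,1)`. -/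
def AlleeType (f : ℝ → ℝ) (θ : ℝ) : Prop :=
  ContDiffOn ℝ 1 f (Ici (0:ℝ)) ∧ θ ∈ Ico (0:ℝ) 1 ∧
    f 0 = 0 ∧ f θ = 0 ∧ f 1 = 0 ∧
    derivWithin f (Ici (0:ℝ)) 0 ≤ 0 ∧ derivWithin f (Ici (0:ℝ)) 1 < 0 ∧
    (∀ u ∈ Icc (0:ℝ) θ, f u ≤ 0) ∧ (∀ u ∈ Ioo θ (1:ℝ), 0 < f u) ∧
    (∀ u ∈ Ioi (1:ℝ), f u < 0) ∧ 0 < ∫ s in (0:ℝ)..1, f s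

/-- `θs` is the number `θ*_f ∈ [θ,1)` attached to an Allee type `f`. -/
def IsThetaStar (f : ℝ → ℝ) (θ θs : ℝ) : Prop :=
  θs ∈ Ico θ (1:ℝ) ∧ (∫ s in (0:ℝ)..θs, f s) = 0 ∧
    ∀ u ∈ Ioc θs (1:ℝ), 0 < ∫ s in (0:ℝ)..u, f s

/-- Membership in the initial class `X(h₀)`. -/
def InX (δ h₀ : ℝ) (φ : ℝ → ℝ) : Prop :=
  ContDiffOn ℝ 2 φ (Icc (-h₀) h₀) ∧ φ (-h₀) = δ ∧ φ h₀ = δ ∧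
    ∀ x ∈ Icc (-h₀) h₀, 0 < φ x

/-- A classical solution `(u,g,h)` of the free boundary problem (with reaction
term `f = f(t,x,u)`) with initial datum `u₀ ∈ X(h₀)` on the time interval `I`. -/
structure ClassicalSolution (d δ h₀ : ℝ) (f : ℝ → ℝ → ℝ → ℝ) (u₀ : ℝ → ℝ)
    (I : Set ℝ) (u : ℝ → ℝ → ℝ) (g h : ℝ → ℝ) : Prop where
  g_reg : ContDiffOn ℝ 1 g I
  h_reg : ContDiffOn ℝ 1 h I
  g_lt_h : ∀ t ∈ I, g t < h t
  u_cont : ContinuousOn (fun p : ℝ × ℝ => u p.1 p.2)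
      {p : ℝ × ℝ | p.1 ∈ I ∧ p.2 ∈ Icc (g p.1) (h p.1)}
  ux_cont : ContinuousOn (fun p : ℝ × ℝ => deriv (u p.1) p.2)
      {p : ℝ × ℝ | p.1 ∈ I ∧ 0 < p.1 ∧ p.2 ∈ Icc (g p.1) (h p.1)}
  ut_diff : ∀ t ∈ I, 0 < t → ∀ x ∈ Ioo (g t) (h t),
      DifferentiableAt ℝ (fun s => u s x) t
  ux_diff : ∀ t ∈ I, 0 < t → ∀ x ∈ Icc (g t) (h t), DifferentiableAt ℝ (u t) x
  uxx_diff : ∀ t ∈ I, 0 < t → ∀ x ∈ Ioo (g t) (h t),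
      DifferentiableAt ℝ (deriv (u t)) x
  ut_cont : ContinuousOn (fun p : ℝ × ℝ => deriv (fun s => u s p.2) p.1)
      {p : ℝ × ℝ | p.1 ∈ I ∧ 0 < p.1 ∧ p.2 ∈ Ioo (g p.1) (h p.1)}
  uxx_cont : ContinuousOn (fun p : ℝ × ℝ => deriv (deriv (u p.1)) p.2)
      {p : ℝ × ℝ | p.1 ∈ I ∧ 0 < p.1 ∧ p.2 ∈ Ioo (g p.1) (h p.1)}
  pde : ∀ t ∈ I, 0 < t → ∀ x ∈ Ioo (g t) (h t),
      deriv (fun s => u s x) t = d * deriv (deriv (u t)) x + f t x (u t x)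
  bc_g : ∀ t ∈ I, 0 < t → u t (g t) = δ
  bc_h : ∀ t ∈ I, 0 < t → u t (h t) = δ
  stefan_g : ∀ t ∈ I, 0 < t → deriv g t = -(d / δ) * deriv (u t) (g t)
  stefan_h : ∀ t ∈ I, 0 < t → deriv h t = -(d / δ) * deriv (u t) (h t)
  g_init : g 0 = -h₀
  h_init : h 0 = h₀
  u_init : ∀ x ∈ Icc (-h₀) h₀, u 0 x = u₀ x

/-- A semi-wave pair `(c,q)` for `(f, δ, d)`. -/
def SemiWavePair (d δ : ℝ) (f : ℝ → ℝ) (c : ℝ) (q : ℝ → ℝ) : Prop :=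
  0 < c ∧ ContDiffOn ℝ 2 q (Ici (0:ℝ)) ∧
    (∀ z ∈ Ici (0:ℝ),
      d * derivWithin (derivWithin q (Ici (0:ℝ))) (Ici (0:ℝ)) z
        - c * derivWithin q (Ici (0:ℝ)) z + f (q z) = 0) ∧
    (∀ z ∈ Ioi (0:ℝ), 0 < q z) ∧ q 0 = δ ∧
    Tendsto q atTop (nhds 1) ∧
    derivWithin q (Ici (0:ℝ)) 0 = c * δ / d ∧
    ∀ z ∈ Ici (0:ℝ), 0 < derivWithin q (Ici (0:ℝ)) z

/-- Condition `(f2)` with Hölder exponent `β`. -/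
def CondF2 (f : ℝ → ℝ → ℝ → ℝ) (β : ℝ) : Prop :=
  β ∈ Ioo (0:ℝ) 1 ∧
    (∀ M > 0, ∃ C > 0, ∀ t₁ ∈ Ici (0:ℝ), ∀ t₂ ∈ Ici (0:ℝ), ∀ x₁ x₂ : ℝ,
        ∀ v ∈ Icc (0:ℝ) M,
        |f t₁ x₁ v - f t₂ x₂ v| ≤ C * (|t₁ - t₂| ^ (β / 2) + |x₁ - x₂| ^ β)) ∧
    (∀ t ∈ Ici (0:ℝ), ∀ x : ℝ, ContDiffOn ℝ 1 (f t x) (Ici (0:ℝ))) ∧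
    (∀ t ∈ Ici (0:ℝ), ∀ x : ℝ, f t x 0 = 0) ∧
    (∀ M > 0, ∃ L > 0, ∀ t ∈ Ici (0:ℝ), ∀ x : ℝ,
        ∀ v₁ ∈ Icc (0:ℝ) M, ∀ v₂ ∈ Icc (0:ℝ) M,
        |f t x v₁ - f t x v₂| ≤ L * |v₁ - v₂|)

/-- Condition `(f3)` with constant `M₀`. -/
def CondF3 (f : ℝ → ℝ → ℝ → ℝ) (M₀ : ℝ) : Prop :=
  0 < M₀ ∧ ∀ t ∈ Ici (0:ℝ), ∀ x : ℝ, ∀ v, M₀ ≤ v → f t x v < 0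

/-- Part (i) of condition `(f4)`, with upper bound function `fbar`. -/
def CondF4i (f : ℝ → ℝ → ℝ → ℝ) (fbar : ℝ → ℝ) (β : ℝ) : Prop :=
  CondF2 f β ∧ (∀ t ∈ Ici (0:ℝ), ∀ x : ℝ, f t x 1 = 0) ∧
    ContinuousOn fbar (Ici (1:ℝ)) ∧
    ∀ t ∈ Ici (0:ℝ), ∀ x : ℝ, ∀ v, 1 < v → f t x v ≤ fbar v ∧ fbar v < 0

/-- Condition `(f4)`, with bounds `fbar` (above, for `u > 1`) and
`funder` (below, of Allee type). -/
def CondF4 (f : ℝ → ℝ → ℝ → ℝ) (fbar funder : ℝ → ℝ) (θ β : ℝ) : Prop :=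
  CondF4i f fbar β ∧ AlleeType funder θ ∧
    ∀ t ∈ Ici (0:ℝ), ∀ x : ℝ, ∀ v, 0 ≤ v → funder v ≤ f t x v

/-- Combustion-type nonlinearity `(f_c)` with ignition value `θ`. -/
def CombustionType (f : ℝ → ℝ) (θ : ℝ) : Prop :=
  ContDiffOn ℝ 1 f (Ici (0:ℝ)) ∧ θ ∈ Ioo (0:ℝ) 1 ∧
    (∀ u ∈ Icc (0:ℝ) θ, f u = 0) ∧ f 1 = 0 ∧ derivWithin f (Ici (0:ℝ)) 1 < 0 ∧
    (∀ u ∈ Ioo θ (1:ℝ), 0 < f u) ∧ (∀ u ∈ Ioi (1:ℝ), f u < 0)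

/-- The (unnormalised) bistable condition `(F_b)` with constants `0 < P < Q`. -/
def CondFb (F : ℝ → ℝ) (P Q : ℝ) : Prop :=
  0 < P ∧ P < Q ∧ ContDiffOn ℝ 1 F (Ici (0:ℝ)) ∧
    F 0 = 0 ∧ F P = 0 ∧ F Q = 0 ∧
    derivWithin F (Ici (0:ℝ)) 0 < 0 ∧ derivWithin F (Ici (0:ℝ)) Q < 0 ∧
    (∀ u ∈ Ioo (0:ℝ) P, F u < 0) ∧ (∀ u ∈ Ioi Q, F u < 0) ∧
    (∀ u ∈ Ioo P Q, 0 < F u) ∧ 0 < ∫ s in (0:ℝ)..Q, F s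

open Topology

lemma aux_second_deriv_nonneg {φ φ' : ℝ → ℝ} {x b : ℝ} (hmin : IsLocalMin φ x)
    (h1 : ∀ᶠ y in 𝓝 x, HasDerivAt φ (φ' y) y) (h2 : HasDerivAt φ' b x) : 0 ≤ b := by
  by_contra hb
  push Not at hb
  have he : deriv φ =ᶠ[𝓝 x] φ' := h1.mono fun y hy => hy.deriv
  have hdd : deriv (deriv φ) x = b := by rw [he.deriv_eq]; exact h2.deriv
  have hc : ContinuousAt φ x := h1.self_of_nhds.continuousAt
  have hmax : IsLocalMax φ x :=
    isLocalMax_of_deriv_deriv_neg (by rw [hdd]; exact hb) hmin.deriv_eq_zero hc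
  have hconst : φ =ᶠ[𝓝 x] fun _ => φ x := by
    filter_upwards [hmin, hmax] with y a1 a2 using le_antisymm a2 a1
  have h3 : deriv φ =ᶠ[𝓝 x] deriv (fun _ => φ x) := hconst.deriv
  have h4 := h3.deriv_eq
  rw [hdd] at h4
  simp at h4
  linarith

lemma aux_deriv_nonpos {φ : ℝ → ℝ} {t a : ℝ} (h0 : φ t = 0)
    (h1 : ∀ᶠ s in 𝓝[<] t, 0 ≤ φ s) (h2 : HasDerivAt φ a t) : a ≤ 0 := by
  have h3 := (hasDerivAt_iff_tendsto_slope.1 h2).mono_left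
    (nhdsWithin_mono t (fun s (hs : s < t) => ne_of_lt hs) : 𝓝[<] t ≤ 𝓝[≠] t)
  refine le_of_tendsto h3 ?_
  filter_upwards [h1, self_mem_nhdsWithin] with s hs hst
  have hst' : s < t := hst
  rw [slope_def_field, h0, ]
  exact div_nonpos_of_nonneg_of_nonpos (by linarith) (by linarith)

lemma aux_touch (g h : ℝ → ℝ) (t0 t1 : ℝ) (v : ℝ → ℝ → ℝ)
    (hg : ContinuousOn g (Icc t0 t1)) (hh : ContinuousOn h (Icc t0 t1))
    (hv : ContinuousOn (fun p : ℝ × ℝ => v p.1 p.2)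
      {p : ℝ × ℝ | p.1 ∈ Icc t0 t1 ∧ p.2 ∈ Icc (g p.1) (h p.1)})
    (hinit : ∀ x ∈ Icc (g t0) (h t0), 0 < v t0 x)
    (hlat : ∀ t ∈ Icc t0 t1, 0 < v t (g t) ∧ 0 < v t (h t))
    (hno : ∀ t ∈ Ioc t0 t1, ∀ x ∈ Ioo (g t) (h t), v t x = 0 → IsLocalMin (v t) x →
      (∀ a, HasDerivAt (fun s => v s x) a t → a ≤ 0) → False) :
    ∀ t ∈ Icc t0 t1, ∀ x ∈ Icc (g t) (h t), 0 < v t x := by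
  intro τ hτ ξ hξ
  by_contra hneg
  push Not at hneg
  obtain ⟨G, hG⟩ := (isCompact_Icc.image_of_continuousOn hg).bddBelow
  obtain ⟨H, hH⟩ := (isCompact_Icc.image_of_continuousOn hh).bddAbove
  set D : Set (ℝ × ℝ) := {p : ℝ × ℝ | p.1 ∈ Icc t0 t1 ∧ p.2 ∈ Icc (g p.1) (h p.1)} with hD
  have hstrip : IsClosed ((Icc t0 t1) ×ˢ (univ : Set ℝ)) := isClosed_Icc.prod isClosed_univ
  have hg1 : ContinuousOn (fun p : ℝ × ℝ => g p.1) ((Icc t0 t1) ×ˢ (univ : Set ℝ)) :=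
    hg.comp continuousOn_fst (fun p hp => hp.1)
  have hh1 : ContinuousOn (fun p : ℝ × ℝ => h p.1) ((Icc t0 t1) ×ˢ (univ : Set ℝ)) :=
    hh.comp continuousOn_fst (fun p hp => hp.1)
  have hDclosed : IsClosed D := by
    have c1 := hstrip.isClosed_le hg1 continuousOn_snd
    have c2 := hstrip.isClosed_le continuousOn_snd hh1
    convert c1.inter c2 using 1
    ext p
    simp only [hD, mem_ofPred_eq, mem_inter_iff, mem_prod, mem_univ, mem_Icc]
    tauto
  have hDcomp : IsCompact D := by
    refine ((isCompact_Icc (a := t0) (b := t1)).prod (isCompact_Icc (a := G) (b := H))).of_isClosed_subset hDclosed ?_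
    rintro ⟨t, x⟩ ⟨h1, h2⟩
    exact ⟨h1, (hG ⟨t, h1, rfl⟩).trans h2.1, h2.2.trans (hH ⟨t, h1, rfl⟩)⟩
  have hBcl : IsClosed {p ∈ D | v p.1 p.2 ≤ 0} := hDclosed.isClosed_le hv continuousOn_const
  have hBcomp : IsCompact {p ∈ D | v p.1 p.2 ≤ 0} :=
    hDcomp.of_isClosed_subset hBcl (fun p hp => hp.1)
  obtain ⟨⟨t, x⟩, ⟨⟨htI, hxI⟩, hvneg⟩, hmin⟩ := hBcomp.exists_isMinOn ⟨(τ, ξ), ⟨hτ, hξ⟩, hneg⟩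
    continuous_fst.continuousOn
  simp only at htI hxI hvneg
  have hpos : ∀ s ∈ Icc t0 t1, s < t → ∀ y ∈ Icc (g s) (h s), 0 < v s y := by
    intro s hs hst y hy
    by_contra hc
    push Not at hc
    have := hmin (show (s, y) ∈ {p ∈ D | v p.1 p.2 ≤ 0} from ⟨⟨hs, hy⟩, hc⟩)
    simp at this
    linarith
  have ht0 : t0 < t := by
    rcases eq_or_lt_of_le htI.1 with e | e
    · subst e
      exact absurd (hinit x hxI) (by linarith)
    · exact e
  have hxl : g t < x := by
    rcases eq_or_lt_of_le hxI.1 with e | e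
    · have := (hlat t htI).1
      rw [e] at this; linarith
    · exact e
  have hxr : x < h t := by
    rcases eq_or_lt_of_le hxI.2 with e | e
    · have := (hlat t htI).2
      rw [← e] at this; linarith
    · exact e
  -- times just before t
  have hev0 : ∀ᶠ s in 𝓝[<] t, s ∈ Icc t0 t1 ∧ s < t := by
    have : Ioo t0 t ∈ 𝓝[<] t := Ioo_mem_nhdsLT ht0
    filter_upwards [this] with s hs
    exact ⟨⟨hs.1.le, hs.2.le.trans htI.2⟩, hs.2⟩
  have hle : 𝓝[<] t ≤ 𝓝[Icc t0 t1] t :=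
    le_inf (nhdsWithin_le_nhds) (le_principal_iff.2 (hev0.mono fun s hs => hs.1))
  have hevin : ∀ y ∈ Ioo (g t) (h t), ∀ᶠ s in 𝓝[<] t, y ∈ Icc (g s) (h s) := by
    intro y hy
    have e1 := ((hg t htI).mono_left hle).eventually (gt_mem_nhds hy.1)
    have e2 := ((hh t htI).mono_left hle).eventually (lt_mem_nhds hy.2)
    filter_upwards [e1, e2] with s h1 h2 using ⟨h1.le, h2.le⟩
  have hev : ∀ y ∈ Ioo (g t) (h t), ∀ᶠ s in 𝓝[<] t, 0 ≤ v s y := by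
    intro y hy
    filter_upwards [hev0, hevin y hy] with s h1 h2 using (hpos s h1.1 h1.2 y h2).le
  have hnn : ∀ y ∈ Ioo (g t) (h t), 0 ≤ v t y := by
    intro y hy
    have hc : Tendsto (fun s => v s y) (𝓝[<] t) (𝓝 (v t y)) := by
      have c0 : ContinuousWithinAt (fun p : ℝ × ℝ => v p.1 p.2) D (t, y) :=
        hv (t, y) ⟨htI, hy.1.le, hy.2.le⟩
      have c1 : Tendsto (fun s : ℝ => (s, y)) (𝓝[<] t) (𝓝[D] (t, y)) := by
        refine tendsto_nhdsWithin_iff.2 ⟨?_, ?_⟩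
        · exact (Continuous.tendsto (by fun_prop) t).mono_left nhdsWithin_le_nhds
        · filter_upwards [hev0, hevin y hy] with s h1 h2 using ⟨h1.1, h2⟩
      exact c0.tendsto.comp c1
    exact ge_of_tendsto hc (hev y hy)
  have hzero : v t x = 0 := le_antisymm hvneg (hnn x ⟨hxl, hxr⟩)
  refine hno t ⟨ht0, htI.2⟩ x ⟨hxl, hxr⟩ hzero ?_ ?_
  · filter_upwards [Ioo_mem_nhds hxl hxr] with y hy
    rw [hzero]; exact hnn y hy
  · intro a ha
    exact aux_deriv_nonpos (φ := fun s => v s x) hzero (hev x ⟨hxl, hxr⟩) ha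

section
variable {d h₀ : ℝ} {f : ℝ → ℝ → ℝ → ℝ} {u₀ : ℝ → ℝ} {u : ℝ → ℝ → ℝ} {g h : ℝ → ℝ}

lemma aux_compare (hd : 0 < d) (hu₀ : InX 1 h₀ u₀)
    (hsol : ClassicalSolution d 1 h₀ f u₀ (Ici (0:ℝ)) u g h)
    (σ t0 t1 : ℝ) (ht0 : 0 ≤ t0) (w : ℝ → ℝ → ℝ)
    (hw : Continuous (fun p : ℝ × ℝ => w p.1 p.2))
    (hinit : ∀ x ∈ Icc (g t0) (h t0), 0 < σ * (u t0 x - w t0 x))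
    (hlat : ∀ t ∈ Icc t0 t1, 0 < σ * (1 - w t (g t)) ∧ 0 < σ * (1 - w t (h t)))
    (hno : ∀ t ∈ Ioc t0 t1, ∀ x ∈ Ioo (g t) (h t), u t x = w t x →
      ∃ wt wxx, ∃ w' : ℝ → ℝ, HasDerivAt (fun s => w s x) wt t ∧
        (∀ᶠ y in 𝓝 x, HasDerivAt (w t) (w' y) y) ∧ HasDerivAt w' wxx x ∧
        0 < σ * (f t x (u t x) + d * wxx - wt)) :
    ∀ t ∈ Icc t0 t1, ∀ x ∈ Icc (g t) (h t), 0 < σ * (u t x - w t x) := by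
  have hsub : Icc t0 t1 ⊆ Ici (0:ℝ) := fun t ht => ht0.trans ht.1
  have hbc : ∀ t ∈ Icc t0 t1, u t (g t) = 1 ∧ u t (h t) = 1 := by
    intro t ht
    rcases eq_or_lt_of_le (show (0:ℝ) ≤ t from hsub ht) with e | e
    · subst e
      have hgh := hsol.g_lt_h 0 (by simp)
      rw [hsol.g_init, hsol.h_init] at hgh ⊢
      rw [hsol.u_init _ ⟨le_rfl, hgh.le⟩, hsol.u_init _ ⟨hgh.le, le_rfl⟩]
      exact ⟨hu₀.2.1, hu₀.2.2.1⟩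
    · exact ⟨hsol.bc_g t (hsub ht) e, hsol.bc_h t (hsub ht) e⟩
  refine aux_touch g h t0 t1 (fun t x => σ * (u t x - w t x)) (hsol.g_reg.continuousOn.mono hsub)
    (hsol.h_reg.continuousOn.mono hsub) ?_ hinit ?_ ?_
  · exact continuousOn_const.mul ((hsol.u_cont.mono fun p hp => ⟨hsub hp.1, hp.2⟩).sub
      hw.continuousOn)
  · intro t ht
    simp only [(hbc t ht).1, (hbc t ht).2]
    exact hlat t ht
  · intro t ht x hx hz hmin hder
    have htp : 0 < t := lt_of_le_of_lt ht0 ht.1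
    have htI : t ∈ Ici (0:ℝ) := htp.le
    by_cases hσ : σ = 0
    · have := (hlat t ⟨ht.1.le, ht.2⟩).1
      rw [hσ] at this; simp at this
    have huw : u t x = w t x := by
      have := (mul_eq_zero.1 hz).resolve_left hσ
      linarith
    obtain ⟨wt, wxx, w', hwt, hw1, hw2, hineq⟩ := hno t ht x hx huw
    have hut := (hsol.ut_diff t htI htp x hx).hasDerivAt
    have e1 := hder _ ((hut.sub hwt).const_mul σ)
    have e2 : 0 ≤ σ * (deriv (deriv (u t)) x - wxx) := by
      refine aux_second_deriv_nonneg (φ' := fun y => σ * (deriv (u t) y - w' y)) hmin ?_ ?_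
      · filter_upwards [hw1, Ioo_mem_nhds hx.1 hx.2] with y h1 h2
        exact (((hsol.ux_diff t htI htp y ⟨h2.1.le, h2.2.le⟩).hasDerivAt).sub h1).const_mul σ
      · exact (((hsol.uxx_diff t htI htp x hx).hasDerivAt).sub hw2).const_mul σ
    rw [hsol.pde t htI htp x hx] at e1
    have e3 := mul_nonneg hd.le e2
    nlinarith

/-- Global upper bound. -/
lemma aux_upper {fbar : ℝ → ℝ} {β : ℝ} (hd : 0 < d) (hf : CondF4i f fbar β) (hu₀ : InX 1 h₀ u₀)
    (hsol : ClassicalSolution d 1 h₀ f u₀ (Ici (0:ℝ)) u g h) :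
    ∃ M, 1 < M ∧ ∀ t, 0 ≤ t → ∀ x ∈ Icc (g t) (h t), u t x < M := by
  obtain ⟨B, hB⟩ := (isCompact_Icc.image_of_continuousOn hu₀.1.continuousOn).bddAbove
  refine ⟨max B 1 + 1, by linarith [le_max_right B 1], ?_⟩
  intro t ht x hx
  have := aux_compare hd hu₀ hsol (-1) 0 t le_rfl (fun _ _ => max B 1 + 1) continuous_const
    ?_ ?_ ?_ t ⟨ht, le_rfl⟩ x hx
  · linarith
  · intro y hy
    rw [hsol.g_init, hsol.h_init] at hy
    rw [hsol.u_init y hy]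
    have := hB ⟨y, hy, rfl⟩
    linarith [le_max_left B 1]
  · intro s _
    have := le_max_right B 1
    constructor <;> linarith
  · intro s hs y hy e
    refine ⟨0, 0, fun _ => 0, hasDerivAt_const _ _, Eventually.of_forall fun z =>
      hasDerivAt_const _ _, hasDerivAt_const _ _, ?_⟩
    have h1 : 1 < u s y := by rw [e]; linarith [le_max_right B 1]
    have := hf.2.2.2 s hs.1.le y (u s y) h1
    linarith

/-- Positivity. -/
lemma aux_pos {fbar : ℝ → ℝ} {β : ℝ} (hd : 0 < d) (hh₀ : 0 < h₀)
    (hf : CondF4i f fbar β) (hu₀ : InX 1 h₀ u₀)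
    (hsol : ClassicalSolution d 1 h₀ f u₀ (Ici (0:ℝ)) u g h) :
    ∀ t, 0 ≤ t → ∀ x ∈ Icc (g t) (h t), 0 < u t x := by
  intro t ht x hx
  obtain ⟨L, hL, hLip⟩ := hf.1.2.2.2.2 1 one_pos
  obtain ⟨z, hz, hzmin⟩ := (isCompact_Icc (a := -h₀) (b := h₀)).exists_isMinOn
    ⟨0, by constructor <;> linarith⟩ hu₀.1.continuousOn
  have hzp := hu₀.2.2.2 z hz
  set η := min (u₀ z) 1 / 2 with hη
  have hηp : 0 < η := by positivity
  have hη1 : η < u₀ z := by have := min_le_left (u₀ z) 1; have : 0 < min (u₀ z) 1 := by positivity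
                            linarith
  have hη2 : η < 1 := by have := min_le_right (u₀ z) 1; linarith
  have hw1 : ∀ s, 0 ≤ s → η * Real.exp (-(L + 1) * s) ≤ η := by
    intro s hs
    have : Real.exp (-(L + 1) * s) ≤ 1 := Real.exp_le_one_iff.2 (by nlinarith)
    nlinarith
  have := aux_compare hd hu₀ hsol 1 0 t le_rfl (fun s _ => η * Real.exp (-(L + 1) * s))
    (by fun_prop) ?_ ?_ ?_ t ⟨ht, le_rfl⟩ x hx
  · have : 0 < η * Real.exp (-(L + 1) * t) := by positivity
    linarith
  · intro y hy
    rw [hsol.g_init, hsol.h_init] at hy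
    rw [hsol.u_init y hy]
    have : u₀ z ≤ u₀ y := hzmin hy
    simp
    linarith
  · intro s hs
    have := hw1 s hs.1
    constructor <;> linarith
  · intro s hs y hy e
    refine ⟨-(L + 1) * (η * Real.exp (-(L + 1) * s)), 0, fun _ => 0, ?_, Eventually.of_forall fun z =>
      hasDerivAt_const _ _, hasDerivAt_const _ _, ?_⟩
    · have h5 : HasDerivAt (fun s : ℝ => -(L + 1) * s) (-(L + 1) * 1) s :=
        (hasDerivAt_id s).const_mul (-(L + 1))
      exact (h5.exp.const_mul η).congr_deriv (by ring)
    · have hp : 0 < η * Real.exp (-(L + 1) * s) := by positivity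
      have h1 := hLip s hs.1.le y (u s y) (by rw [e]; exact ⟨hp.le, by linarith [hw1 s hs.1.le]⟩)
        0 ⟨le_rfl, zero_le_one⟩
      rw [hf.1.2.2.2.1 s hs.1.le y, sub_zero, sub_zero, e, abs_of_pos hp] at h1
      have h2 := neg_abs_le (f s y (η * Real.exp (-(L + 1) * s)))
      rw [e]
      nlinarith

/-- Uniform upper limit. -/
lemma aux_limsup {fbar : ℝ → ℝ} {β : ℝ} (hd : 0 < d) (hf : CondF4i f fbar β) (hu₀ : InX 1 h₀ u₀)
    (hsol : ClassicalSolution d 1 h₀ f u₀ (Ici (0:ℝ)) u g h) (ε : ℝ) (hε : 0 < ε) :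
    ∃ T, 0 < T ∧ ∀ t, T ≤ t → ∀ x ∈ Icc (g t) (h t), u t x < 1 + ε := by
  obtain ⟨M, hM1, hM⟩ := aux_upper hd hf hu₀ hsol
  have hcont : ContinuousOn fbar (Icc (1 + ε) (max M (1 + ε))) :=
    hf.2.2.1.mono fun v hv => by have := hv.1; simp only [mem_Ici]; linarith
  obtain ⟨z, hz, hzmax⟩ := (isCompact_Icc (a := 1 + ε) (b := max M (1 + ε))).exists_isMaxOn
    ⟨1 + ε, le_rfl, le_max_right _ _⟩ hcont
  have hzneg : fbar z < 0 := (hf.2.2.2 0 (by simp) 0 z (by linarith [hz.1])).2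
  set m := -fbar z with hm
  have hmp : 0 < m := by linarith
  set N := max M (1 + ε) with hN
  have hNge : 1 + ε ≤ N := le_max_right _ _
  set T := (N - (1 + ε)) / (m / 2) with hT
  have hTm : m / 2 * T = N - (1 + ε) := by rw [hT]; field_simp
  have hTnn : 0 ≤ T := div_nonneg (by linarith) (by linarith)
  refine ⟨T + 1, by linarith, fun t ht x hx => ?_⟩
  have := aux_compare hd hu₀ hsol (-1) (t - T) t (by linarith)
    (fun s _ => 1 + ε + m / 2 * (t - s)) (by fun_prop) ?_ ?_ ?_ t ⟨by linarith, le_rfl⟩ x hx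
  · simp at this
    linarith
  · intro y hy
    have := hM (t - T) (by linarith) y hy
    have := le_max_left M (1 + ε)
    have e : m / 2 * (t - (t - T)) = N - (1 + ε) := by rw [← hTm]; ring
    rw [e]
    linarith
  · intro s hs
    have : 0 ≤ m / 2 * (t - s) := mul_nonneg (by linarith) (by linarith [hs.2])
    constructor <;> linarith
  · intro s hs y hy e
    refine ⟨m / 2 * (-1), 0, fun _ => 0, ?_, Eventually.of_forall fun z =>
      hasDerivAt_const _ _, hasDerivAt_const _ _, ?_⟩
    · exact (((hasDerivAt_id s).const_sub t).const_mul (m / 2)).const_add (1 + ε)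
    · have e0 : 0 ≤ m / 2 * (t - s) := mul_nonneg (by linarith) (by linarith [hs.2])
      have e1 : m / 2 * (t - s) ≤ m / 2 * T :=
        mul_le_mul_of_nonneg_left (by linarith [hs.1]) (by linarith)
      have h1 := hf.2.2.2 s (by have := hs.1; simp only [mem_Ici]; linarith) y (u s y) (by linarith)
      have h2 : fbar (u s y) ≤ fbar z := hzmax ⟨by linarith, by linarith⟩
      linarith

end

lemma aux_deriv_nonneg {φ : ℝ → ℝ} {t a : ℝ} (h0 : φ t = 0)
    (h1 : ∀ᶠ s in 𝓝[>] t, 0 ≤ φ s) (h2 : HasDerivAt φ a t) : 0 ≤ a := by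
  have h3 := (hasDerivAt_iff_tendsto_slope.1 h2).mono_left
    (nhdsWithin_mono t (fun s (hs : t < s) => ne_of_gt hs) : 𝓝[>] t ≤ 𝓝[≠] t)
  refine ge_of_tendsto h3 ?_
  filter_upwards [h1, self_mem_nhdsWithin] with s hs hst
  have hst' : t < s := hst
  rw [slope_def_field, h0]
  exact div_nonneg (by linarith) (by linarith)

section
variable {d h₀ : ℝ} {f : ℝ → ℝ → ℝ → ℝ} {u₀ : ℝ → ℝ} {u : ℝ → ℝ → ℝ} {g h : ℝ → ℝ}

set_option maxHeartbeats 1000000 in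
/-- Comparison with the explicit parabolic barrier. -/
lemma aux_barrier {fbar : ℝ → ℝ} {β : ℝ} (hd : 0 < d) (hf : CondF4i f fbar β) (hu₀ : InX 1 h₀ u₀)
    (hsol : ClassicalSolution d 1 h₀ f u₀ (Ici (0:ℝ)) u g h) (s A H0 ε xc ℓ : ℝ) (hs : 0 < s)
    (hA : 0 < A) (hH0 : 0 < H0) (hAH : 24 * A * H0 ^ 2 ≤ 1)
    (hxg : g s = xc - ℓ) (hxh : h s = xc + ℓ) (hℓ : 0 < ℓ) (hℓH : ℓ < H0)
    (hu : ∀ x ∈ Icc (g s) (h s), u s x ≤ 1 + ε) (hε : ε < A * (H0 ^ 2 - ℓ ^ 2)) :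
    ∀ t, s ≤ t → h t < xc + H0 * (1 + 24 * A * H0 ^ 2) ∧
      xc - H0 * (1 + 24 * A * H0 ^ 2) < g t := by
  set lam := d / (4 * H0 ^ 2) with hlam
  have hlamp : 0 < lam := by positivity
  have hlamH : lam * (4 * H0 ^ 2) = d := by rw [hlam]; field_simp
  set e : ℝ → ℝ := fun t => Real.exp (-lam * (t - s)) with he
  have hep : ∀ t, 0 < e t := fun t => Real.exp_pos _
  have hele : ∀ t, s ≤ t → e t ≤ 1 := fun t ht => Real.exp_le_one_iff.2 (by nlinarith)
  have hed : ∀ t, HasDerivAt e (-lam * e t) t := by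
    intro t
    have h5 : HasDerivAt (fun t : ℝ => -lam * (t - s)) (-lam * 1) t :=
      ((hasDerivAt_id t).sub_const s).const_mul (-lam)
    exact h5.exp.congr_deriv (by simp only [he]; ring)
  have hec : Continuous e := by simp only [he]; fun_prop
  set K := 24 * A * H0 ^ 3 with hK
  have hKp : 0 < K := by positivity
  have hKH : K ≤ H0 := by
    have : K = (24 * A * H0 ^ 2) * H0 := by rw [hK]; ring
    rw [this]; nlinarith
  have hKlam : K * lam = 6 * d * A * H0 := by rw [← hlamH, hK]; ring
  set H : ℝ → ℝ := fun t => H0 + K * (1 - e t) with hHdef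
  have hHge : ∀ t, s ≤ t → H0 ≤ H t := by
    intro t ht
    have := hele t ht
    simp only [hHdef]; nlinarith
  have hHlt : ∀ t, H t < H0 * (1 + 24 * A * H0 ^ 2) := by
    intro t
    have := hep t
    have e1 : H0 * (1 + 24 * A * H0 ^ 2) = H0 + K := by rw [hK]; ring
    rw [e1]
    simp only [hHdef]; nlinarith
  have hHle : ∀ t, H t ≤ 2 * H0 := by
    intro t
    have := hep t
    simp only [hHdef]; nlinarith
  have hHd : ∀ t, HasDerivAt H (6 * d * A * H0 * e t) t := by
    intro t
    refine ((((hed t).const_sub 1).const_mul K).const_add H0).congr_deriv ?_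
    rw [← hKlam]; ring
  have hHc : Continuous H := by simp only [hHdef]; fun_prop
  have hs0 : e s = 1 := by simp [he]
  have hHs : H s = H0 := by simp [hHdef, hs0]
  set w : ℝ → ℝ → ℝ := fun t x => 1 + A * e t * (H t ^ 2 - (x - xc) ^ 2) with hw
  have hwc : Continuous (fun p : ℝ × ℝ => w p.1 p.2) := by simp only [hw]; fun_prop
  have hwx : ∀ t x, HasDerivAt (w t) (A * e t * (-(2 * (x - xc)))) x := by
    intro t x
    have h5 : HasDerivAt (fun x : ℝ => (x - xc) ^ 2) (2 * (x - xc)) x := by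
      refine (((hasDerivAt_id x).sub_const xc).pow 2).congr_deriv ?_
      simp
    exact (((h5.const_sub (H t ^ 2)).const_mul (A * e t)).const_add 1)
  -- comparison inside
  have hcmp : ∀ t1, s ≤ t1 → (∀ τ ∈ Icc s t1, xc - H τ < g τ ∧ h τ < xc + H τ) →
      ∀ x ∈ Icc (g t1) (h t1), u t1 x < w t1 x := by
    intro t1 ht1 hin x hx
    have hpos : ∀ τ ∈ Icc s t1, ∀ y ∈ Icc (g τ) (h τ), 1 < w τ y := by
      intro τ hτ y hy
      have h1 := hin τ hτ
      have h2 : 0 < (H τ - (y - xc)) * (H τ + (y - xc)) :=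
        mul_pos (by linarith [hy.2]) (by linarith [hy.1])
      have h3 : 0 < A * e τ := mul_pos hA (hep τ)
      have h4 := mul_pos h3 h2
      simp only [hw]
      nlinarith
    have hgl : ∀ τ ∈ Icc s t1, g τ ≤ h τ := fun τ hτ =>
      (hsol.g_lt_h τ (hs.le.trans hτ.1)).le
    have := aux_compare hd hu₀ hsol (-1) s t1 hs.le w hwc ?_ ?_ ?_ t1 ⟨ht1, le_rfl⟩ x hx
    · linarith
    · intro y hy
      have h1 := hu y hy
      have h2 : 0 ≤ (ℓ - (y - xc)) * (ℓ + (y - xc)) :=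
        mul_nonneg (by linarith [hy.2]) (by linarith [hy.1])
      simp only [hw, hs0, hHs]
      have h3 := mul_nonneg hA.le h2
      nlinarith
    · intro τ hτ
      have h1 := hpos τ hτ (g τ) ⟨le_rfl, hgl τ hτ⟩
      have h2 := hpos τ hτ (h τ) ⟨hgl τ hτ, le_rfl⟩
      constructor <;> linarith
    · intro τ hτ y hy heq
      have hτ' : τ ∈ Icc s t1 := ⟨hτ.1.le, hτ.2⟩
      refine ⟨A * (-lam * e τ) * (H τ ^ 2 - (y - xc) ^ 2)
        + A * e τ * (2 * H τ * (6 * d * A * H0 * e τ)), A * e τ * (-(2 * 1)),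
        fun x => A * e τ * (-(2 * (x - xc))), ?_, Eventually.of_forall fun z => hwx τ z, ?_, ?_⟩
      · have h5 : HasDerivAt (fun t => H t ^ 2 - (y - xc) ^ 2)
            (2 * H τ * (6 * d * A * H0 * e τ)) τ := by
          refine (((hHd τ).pow 2).sub_const _).congr_deriv ?_
          simp
        exact (((hed τ).const_mul A).mul h5).const_add 1
      · exact ((((hasDerivAt_id y).sub_const xc).const_mul 2).neg).const_mul _
      · have h1 : 1 < u τ y := by rw [heq]; exact hpos τ hτ' y ⟨hy.1.le, hy.2.le⟩
        have h2 := hf.2.2.2 τ (hs.le.trans hτ'.1) y (u τ y) h1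
        have h3 : 0 < A * e τ := mul_pos hA (hep τ)
        have hHn : 0 < H τ := lt_of_lt_of_le hH0 (hHge τ hτ'.1)
        have h4 : 0 < 2 * H τ * (6 * d * A * H0 * e τ) := by
          have := hep τ
          positivity
        have h5 : lam * (H τ ^ 2 - (y - xc) ^ 2) ≤ d := by
          rw [← hlamH]
          apply mul_le_mul_of_nonneg_left _ hlamp.le
          have := hHle τ
          nlinarith [sq_nonneg (y - xc)]
        have h6 := mul_pos h3 h4
        have h7 := mul_le_mul_of_nonneg_left h5 h3.le
        have h8 := mul_pos h3 hd
        nlinarith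
  -- staying inside
  have hin : ∀ t, s ≤ t → xc - H t < g t ∧ h t < xc + H t := by
    intro t ht
    by_contra hbad
    have hsub : Icc s t ⊆ Ici (0:ℝ) := fun τ hτ => hs.le.trans hτ.1
    have hgc := hsol.g_reg.continuousOn.mono hsub
    have hhc := hsol.h_reg.continuousOn.mono hsub
    have hcl1 : IsClosed {τ ∈ Icc s t | g τ ≤ xc - H τ} :=
      isClosed_Icc.isClosed_le hgc (by fun_prop)
    have hcl2 : IsClosed {τ ∈ Icc s t | xc + H τ ≤ h τ} :=
      isClosed_Icc.isClosed_le (by fun_prop) hhc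
    set B := {τ ∈ Icc s t | g τ ≤ xc - H τ} ∪ {τ ∈ Icc s t | xc + H τ ≤ h τ} with hB
    have hBsub : B ⊆ Icc s t := union_subset (fun τ hτ => hτ.1) (fun τ hτ => hτ.1)
    have hBc : IsCompact B := isCompact_Icc.of_isClosed_subset (hcl1.union hcl2) hBsub
    have hBne : B.Nonempty := by
      refine ⟨t, ?_⟩
      rw [not_and_or] at hbad
      push Not at hbad
      rcases hbad with hb | hb
      · exact Or.inl ⟨⟨ht, le_rfl⟩, hb⟩
      · exact Or.inr ⟨⟨ht, le_rfl⟩, hb⟩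
    obtain ⟨t1, ht1B, hmin⟩ := hBc.exists_isMinOn hBne continuousOn_id
    have ht1 := hBsub ht1B
    have hbefore : ∀ τ ∈ Ico s t1, xc - H τ < g τ ∧ h τ < xc + H τ := by
      intro τ hτ
      have hτI : τ ∈ Icc s t := ⟨hτ.1, hτ.2.le.trans ht1.2⟩
      by_contra hb
      have hmem : τ ∈ B := by
        rw [not_and_or] at hb
        push Not at hb
        rcases hb with hb | hb
        · exact Or.inl ⟨hτI, hb⟩
        · exact Or.inr ⟨hτI, hb⟩
      have : t1 ≤ τ := hmin hmem
      linarith [hτ.2]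
    have hst1 : s < t1 := by
      rcases eq_or_lt_of_le ht1.1 with e1 | e1
      · exfalso
        rw [← e1] at ht1B
        rcases ht1B with hb | hb
        · have := hb.2
          rw [hHs, hxg] at this; linarith
        · have := hb.2
          rw [hHs, hxh] at this; linarith
      · exact e1
    have ht1p : 0 < t1 := hs.trans hst1
    have ht1I : t1 ∈ Ici (0:ℝ) := ht1p.le
    have hgd : HasDerivAt g (deriv g t1) t1 :=
      ((hsol.g_reg.differentiableOn one_ne_zero).differentiableAt (Ici_mem_nhds ht1p)).hasDerivAt
    have hhd : HasDerivAt h (deriv h t1) t1 :=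
      ((hsol.h_reg.differentiableOn one_ne_zero).differentiableAt (Ici_mem_nhds ht1p)).hasDerivAt
    have hIoo : Ioo s t1 ∈ 𝓝[<] t1 := Ioo_mem_nhdsLT hst1
    have hule : ∀ x ∈ Ioo (g t1) (h t1), 0 ≤ w t1 x - u t1 x := by
      intro x hx
      have hut := (hsol.ut_diff t1 ht1I ht1p x hx).continuousAt
      have hwt : ContinuousAt (fun τ => w τ x) t1 := by
        simp only [hw]; fun_prop
      have htend : Tendsto (fun τ => w τ x - u τ x) (𝓝[<] t1) (𝓝 (w t1 x - u t1 x)) :=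
        ((hwt.sub hut).tendsto).mono_left nhdsWithin_le_nhds
      refine ge_of_tendsto htend ?_
      have e1 := (hgd.continuousAt.tendsto.mono_left
        (nhdsWithin_le_nhds (s := Iio t1))).eventually (gt_mem_nhds hx.1)
      have e2 := (hhd.continuousAt.tendsto.mono_left
        (nhdsWithin_le_nhds (s := Iio t1))).eventually (lt_mem_nhds hx.2)
      filter_upwards [e1, e2, hIoo] with τ h1 h2 h3
      have := hcmp τ h3.1.le (fun τ' hτ' => hbefore τ' ⟨hτ'.1, lt_of_le_of_lt hτ'.2 h3.2⟩)
        x ⟨h1.le, h2.le⟩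
      linarith
    have hgh1 := hsol.g_lt_h t1 ht1I
    have hexp := hep t1
    have hAe : 0 < A * e t1 := mul_pos hA hexp
    have hstrict : 2 * (d * (A * e t1)) * H t1 < 6 * d * A * H0 * e t1 := by
      have h1 := mul_pos hd hAe
      have h2 := mul_le_mul_of_nonneg_left (hHle t1) (mul_pos two_pos h1).le
      have h3 := mul_pos h1 hH0
      nlinarith
    have hble : xc - H t1 ≤ g t1 ∧ h t1 ≤ xc + H t1 := by
      have l1 : Tendsto (fun τ => g τ - (xc - H τ)) (𝓝[<] t1) (𝓝 (g t1 - (xc - H t1))) :=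
        ((hgd.continuousAt.sub (by fun_prop)).tendsto).mono_left nhdsWithin_le_nhds
      have l2 : Tendsto (fun τ => (xc + H τ) - h τ) (𝓝[<] t1) (𝓝 ((xc + H t1) - h t1)) :=
        ((ContinuousAt.sub (by fun_prop) hhd.continuousAt).tendsto).mono_left nhdsWithin_le_nhds
      have m1 := ge_of_tendsto l1 (b := 0) (by
        filter_upwards [hIoo] with τ h3
        linarith [(hbefore τ ⟨h3.1.le, h3.2⟩).1])
      have m2 := ge_of_tendsto l2 (b := 0) (by
        filter_upwards [hIoo] with τ h3
        linarith [(hbefore τ ⟨h3.1.le, h3.2⟩).2])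
      constructor <;> linarith
    rcases ht1B with hb | hb
    · have hgeq : g t1 = xc - H t1 := le_antisymm hb.2 hble.1
      have hux := (hsol.ux_diff t1 ht1I ht1p (g t1) ⟨le_rfl, hgh1.le⟩).hasDerivAt
      have k1 := aux_deriv_nonneg (φ := fun x => w t1 x - u t1 x) (t := g t1)
        (by simp only [hw]; rw [hsol.bc_g t1 ht1I ht1p, hgeq]; ring)
        (by filter_upwards [Ioo_mem_nhdsGT hgh1] with x hx using hule x hx)
        ((hwx t1 (g t1)).sub hux)
      have k2 := aux_deriv_nonpos (φ := fun τ => g τ - (xc - H τ)) (t := t1)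
        (by simp only [hgeq]; ring)
        (by filter_upwards [hIoo] with τ h3
            linarith [(hbefore τ ⟨h3.1.le, h3.2⟩).1])
        (hgd.sub ((hHd t1).const_sub xc))
      rw [hsol.stefan_g t1 ht1I ht1p] at k2
      rw [hgeq] at k1 k2
      have k3 := mul_nonneg hd.le k1
      rw [div_one] at k2
      linarith
    · have hgeq : h t1 = xc + H t1 := le_antisymm hble.2 hb.2
      have hux := (hsol.ux_diff t1 ht1I ht1p (h t1) ⟨hgh1.le, le_rfl⟩).hasDerivAt
      have k1 := aux_deriv_nonpos (φ := fun x => w t1 x - u t1 x) (t := h t1)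
        (by simp only [hw]; rw [hsol.bc_h t1 ht1I ht1p, hgeq]; ring)
        (by filter_upwards [Ioo_mem_nhdsLT hgh1] with x hx using hule x hx)
        ((hwx t1 (h t1)).sub hux)
      have k2 := aux_deriv_nonpos (φ := fun τ => (xc + H τ) - h τ) (t := t1)
        (by simp only [hgeq]; ring)
        (by filter_upwards [hIoo] with τ h3
            linarith [(hbefore τ ⟨h3.1.le, h3.2⟩).2])
        (((hHd t1).const_add xc).sub hhd)
      rw [hsol.stefan_h t1 ht1I ht1p] at k2
      rw [hgeq] at k1 k2
      have k3 := mul_nonneg hd.le (sub_nonneg.2 k1)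
      rw [div_one] at k2
      linarith
  intro t ht
  have h1 := hin t ht
  have h2 := hHlt t
  constructor <;> linarith

end

lemma aux_tendsto (φ : ℝ → ℝ) (S0 R : ℝ) (hR : ∀ t, S0 ≤ t → -R ≤ φ t ∧ φ t ≤ R)
    (hφ : ∀ η > 0, ∃ S, ∀ s, S ≤ s → ∀ t, s ≤ t → φ t ≤ φ s + η) :
    ∃ l, Tendsto φ atTop (𝓝 l) := by
  have b1 : IsBoundedUnder (· ≤ ·) atTop φ :=
    ⟨R, eventually_map.2 ((eventually_ge_atTop S0).mono fun t ht => (hR t ht).2)⟩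
  have b2 : IsBoundedUnder (· ≥ ·) atTop φ :=
    ⟨-R, eventually_map.2 ((eventually_ge_atTop S0).mono fun t ht => (hR t ht).1)⟩
  refine ⟨limsup φ atTop, tendsto_of_le_liminf_of_limsup_le ?_ le_rfl b1 b2⟩
  refine le_of_forall_pos_le_add fun η hη => ?_
  obtain ⟨S, hS⟩ := hφ η hη
  have : limsup φ atTop - η ≤ liminf φ atTop := by
    refine le_liminf_of_le b1.isCoboundedUnder_ge ?_
    filter_upwards [eventually_ge_atTop S] with s hs
    have : limsup φ atTop ≤ φ s + η :=
      limsup_le_of_le b2.isCoboundedUnder_le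
        ((eventually_ge_atTop s).mono fun t ht => hS s hs t ht)
    linarith
  linarith

section
variable {d h₀ : ℝ} {f : ℝ → ℝ → ℝ → ℝ} {u₀ : ℝ → ℝ} {u : ℝ → ℝ → ℝ} {g h : ℝ → ℝ}

lemma aux_barrier' {fbar : ℝ → ℝ} {β : ℝ} (hd : 0 < d) (hf : CondF4i f fbar β) (hu₀ : InX 1 h₀ u₀)
    (hsol : ClassicalSolution d 1 h₀ f u₀ (Ici (0:ℝ)) u g h) (s a κ ε : ℝ) (hs : 0 < s)
    (ha : 0 < a) (ha1 : 24 * a ≤ 1) (hκ : 0 < κ) 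
    (hu : ∀ x ∈ Icc (g s) (h s), u s x ≤ 1 + ε) (hε : ε * (1 + κ) ^ 2 < a * (2 * κ + κ ^ 2)) :
    ∀ t, s ≤ t → h t ≤ h s + (h s - g s) / 2 * (κ + 24 * a * (1 + κ)) ∧
      g s - (h s - g s) / 2 * (κ + 24 * a * (1 + κ)) ≤ g t := by
  intro t ht
  have hgh := hsol.g_lt_h s hs.le
  set ℓ := (h s - g s) / 2 with hℓ
  have hℓp : 0 < ℓ := by rw [hℓ]; linarith
  set H0 := ℓ * (1 + κ) with hH0
  have hH0p : 0 < H0 := by positivity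
  have hAH : a / H0 ^ 2 * H0 ^ 2 = a := by field_simp
  have h24 : 24 * (a / H0 ^ 2) * H0 ^ 2 = 24 * a := by rw [mul_assoc, hAH]
  have := aux_barrier hd hf hu₀ hsol s (a / H0 ^ 2) H0 ε ((h s + g s) / 2) ℓ hs (by positivity) hH0p
    (by rw [h24]; exact ha1) (by rw [hℓ]; ring) (by rw [hℓ]; ring) hℓp
    (by rw [hH0]; nlinarith) hu ?_ t ht
  · rw [h24] at this
    have e1 : H0 * (1 + 24 * a) = ℓ + ℓ * (κ + 24 * a * (1 + κ)) := by rw [hH0]; ring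
    rw [e1] at this
    constructor
    · linarith [this.1]
    · linarith [this.2]
  · have e2 : a / H0 ^ 2 * (H0 ^ 2 - ℓ ^ 2) = a * (2 * κ + κ ^ 2) / (1 + κ) ^ 2 := by
      rw [hH0]; field_simp; ring
    rw [e2, lt_div_iff₀ (by positivity)]
    exact hε

lemma aux_boundaries {fbar : ℝ → ℝ} {β : ℝ} (hd : 0 < d) (hf : CondF4i f fbar β) (hu₀ : InX 1 h₀ u₀)
    (hsol : ClassicalSolution d 1 h₀ f u₀ (Ici (0:ℝ)) u g h) :
    (∃ S R, 0 < S ∧ 0 < R ∧ ∀ t, S ≤ t → -R ≤ g t ∧ h t ≤ R) ∧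
    (∃ ginf : ℝ, Tendsto g atTop (𝓝 ginf)) ∧ (∃ hinf : ℝ, Tendsto h atTop (𝓝 hinf)) := by
  have hbd : ∃ S R, 0 < S ∧ 0 < R ∧ ∀ t, S ≤ t → -R ≤ g t ∧ h t ≤ R := by
    obtain ⟨T, hT, hTu⟩ := aux_limsup hd hf hu₀ hsol (1 / 64) (by norm_num)
    have hgh := hsol.g_lt_h T hT.le
    refine ⟨T, |h T| + |g T| + 2 * (h T - g T), hT, by linarith [abs_nonneg (h T), abs_nonneg (g T)], fun t ht => ?_⟩
    have := aux_barrier' hd hf hu₀ hsol T (1 / 24) 1 (1 / 64) hT (by norm_num) (by norm_num)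
      (by norm_num) (fun x hx => (hTu T le_rfl x hx).le) (by norm_num) t ht
    have a1 := neg_abs_le (g T)
    have a2 := le_abs_self (h T)
    have a3 := abs_nonneg (g T)
    have a4 := abs_nonneg (h T)
    constructor
    · linarith [this.2]
    · linarith [this.1]
  obtain ⟨S0, R, hS0, hR, hbR⟩ := hbd
  have hbR' : ∀ t, S0 ≤ t → (-R ≤ g t ∧ g t ≤ R) ∧ (-R ≤ h t ∧ h t ≤ R) := by
    intro t ht
    have := hbR t ht
    have hgh := hsol.g_lt_h t (hS0.le.trans ht)
    refine ⟨⟨?_, ?_⟩, ?_, ?_⟩ <;> linarith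
  have hmono : ∀ η > 0, ∃ S, ∀ s, S ≤ s → ∀ t, s ≤ t → h t ≤ h s + η ∧ g s - η ≤ g t := by
    intro η hη
    set κ := min (1 / 24) (η / (49 * R)) with hκ
    have hκp : 0 < κ := lt_min (by norm_num) (by positivity)
    have hκ1 : κ ≤ 1 / 24 := min_le_left _ _
    have hκ2 : κ * (49 * R) ≤ η := by
      have := min_le_right (1 / 24) (η / (49 * R))
      rwa [le_div_iff₀ (by positivity)] at this
    obtain ⟨T, hT, hTu⟩ := aux_limsup hd hf hu₀ hsol (κ ^ 2 / 4) (by positivity)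
    refine ⟨max T S0, fun s hs t ht => ?_⟩
    have hsT : T ≤ s := (le_max_left _ _).trans hs
    have hsS : S0 ≤ s := (le_max_right _ _).trans hs
    have := aux_barrier' hd hf hu₀ hsol s κ κ (κ ^ 2 / 4) (by linarith) hκp (by linarith)
      hκp (fun x hx => (hTu s hsT x hx).le) (by nlinarith [pow_pos hκp 2, pow_pos hκp 3]) t ht
    have hgh := hsol.g_lt_h s (hS0.le.trans hsS)
    have b := hbR s hsS
    have c1 : (h s - g s) / 2 ≤ R := by linarith
    have c2 : κ + 24 * κ * (1 + κ) ≤ 49 * κ := by nlinarith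
    have c3 : (h s - g s) / 2 * (κ + 24 * κ * (1 + κ)) ≤ R * (49 * κ) :=
      mul_le_mul c1 c2 (by positivity) hR.le
    constructor
    · linarith [this.1]
    · linarith [this.2]
  refine ⟨⟨S0, R, hS0, hR, hbR⟩, ?_, ?_⟩
  · obtain ⟨l, hl⟩ := aux_tendsto (fun t => -g t) S0 R
      (fun t ht => ⟨by linarith [(hbR' t ht).1.2], by linarith [(hbR' t ht).1.1]⟩)
      (fun η hη => by
        obtain ⟨S, hS⟩ := hmono η hη
        exact ⟨S, fun s hs t ht => by linarith [(hS s hs t ht).2]⟩)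
    exact ⟨-l, by simpa using hl.neg⟩
  · exact aux_tendsto h S0 R (fun t ht => (hbR' t ht).2)
      (fun η hη => by
        obtain ⟨S, hS⟩ := hmono η hη
        exact ⟨S, fun s hs t ht => (hS s hs t ht).1⟩)

end

lemma aux_ode (ρ : ℝ → ℝ) (C : ℝ) (hρc : Continuous ρ) (hρ : ∀ y, 0 < ρ y) (hC : ∀ y, ρ y ≤ C) :
    ∃ r : ℝ → ℝ, (∀ y, HasDerivAt r (ρ (r y)) y) ∧ r 0 = 0 ∧ StrictMono r ∧
      Function.Surjective r := by
  have hCp : 0 < C := (hρ 0).trans_le (hC 0)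
  have hic : Continuous fun y => (ρ y)⁻¹ := hρc.inv₀ fun y => (hρ y).ne'
  set G : ℝ → ℝ := fun y => ∫ s in (0:ℝ)..y, (ρ s)⁻¹ with hG
  have hGd : ∀ y, HasDerivAt G (ρ y)⁻¹ y := fun y =>
    intervalIntegral.integral_hasDerivAt_right (hic.intervalIntegrable _ _)
      (hic.stronglyMeasurableAtFilter _ _) hic.continuousAt
  have hG0 : G 0 = 0 := by simp [hG]
  have hGm : StrictMono G := strictMono_of_deriv_pos fun y => by
    rw [(hGd y).deriv]; exact inv_pos.2 (hρ y)
  have hGc : Continuous G := continuous_iff_continuousAt.2 fun y => (hGd y).continuousAt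
  have hm2 : Monotone fun y => G y - C⁻¹ * y := by
    have hd2 : ∀ y, HasDerivAt (fun y => G y - C⁻¹ * y) ((ρ y)⁻¹ - C⁻¹ * 1) y := fun y =>
      (hGd y).sub ((hasDerivAt_id y).const_mul _)
    refine monotone_of_deriv_nonneg (fun y => (hd2 y).differentiableAt) fun y => ?_
    rw [(hd2 y).deriv, mul_one, sub_nonneg]
    exact inv_anti₀ (hρ y) (hC y)
  have hsurj : Function.Surjective G := by
    have hCi : 0 < C⁻¹ := inv_pos.2 hCp
    refine hGc.surjective ?_ ?_
    · refine tendsto_atTop_mono' _ ?_ (tendsto_id.const_mul_atTop hCi)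
      filter_upwards [eventually_ge_atTop (0:ℝ)] with y hy
      have := hm2 hy
      simp [hG0] at this
      simpa using this
    · refine tendsto_atBot_mono' _ ?_ (tendsto_id.const_mul_atBot hCi)
      filter_upwards [eventually_le_atBot (0:ℝ)] with y hy
      have := hm2 hy
      simp [hG0] at this
      simpa using this
  set e := hGm.orderIsoOfSurjective G hsurj with he
  have heG : ∀ y, e y = G y := fun y => rfl
  refine ⟨e.symm, fun y => ?_, ?_, e.symm.strictMono, e.symm.surjective⟩
  · have h1 := HasDerivAt.of_local_left_inverse (f := G) (g := e.symm) (a := y)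
      (e.symm.continuous.continuousAt) (hGd (e.symm y)) (inv_ne_zero (hρ _).ne')
      (Eventually.of_forall fun z => by rw [← heG, e.apply_symm_apply])
    rwa [inv_inv] at h1
  · rw [OrderIso.symm_apply_eq, heG, hG0]

lemma aux_profile (d L θ : ℝ) (F : ℝ → ℝ) (hd : 0 < d) (hF : AlleeType F θ) (hL : 0 < L)
    (hFL : ∀ v ∈ Icc (0:ℝ) 1, F v ≤ L * (1 - v)) :
    ∃ (p p' : ℝ → ℝ) (C κ : ℝ), 0 < C ∧ 0 < κ ∧ Continuous p ∧ (∀ v < 1, 0 < p v) ∧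
      (∀ v < 1, p v ≤ C * (1 - v)) ∧
      ∀ v ∈ Ioo (0:ℝ) 1, HasDerivAt p (p' v) v ∧ d * (p v * p' v) = -F v + κ * (1 - v) := by
  obtain ⟨hreg, hθ, hF0, hFθ, hF1, -, hFd, hneg, hpos, -, hint⟩ := hF
  have hFc : ContinuousOn F (Ici 0) := hreg.continuousOn
  set f1 : ℝ → ℝ := fun v => F (max v 0) with hf1
  have hf1c : Continuous f1 :=
    hFc.comp_continuous (by fun_prop) (fun v => le_max_right v 0)
  have hf1e : ∀ v, 0 ≤ v → f1 v = F v := fun v hv => by simp only [hf1, max_eq_left hv]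
  set E : ℝ → ℝ := fun v => ∫ s in v..1, f1 s with hE
  have hEd : ∀ v, HasDerivAt E (-f1 v) v := fun v =>
    intervalIntegral.integral_hasDerivAt_left (hf1c.intervalIntegrable _ _)
      (hf1c.stronglyMeasurableAtFilter _ _) hf1c.continuousAt
  have hEc : Continuous E := continuous_iff_continuousAt.2 fun v => (hEd v).continuousAt
  have hE1 : E 1 = 0 := by simp [hE]
  have hE0 : 0 < E 0 := by
    have : E 0 = ∫ s in (0:ℝ)..1, F s := by
      refine intervalIntegral.integral_congr fun s hs => ?_
      rw [uIcc_of_le zero_le_one] at hs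
      exact hf1e s hs.1
    rw [this]; exact hint
  have hEpos : ∀ v ∈ Ico (0:ℝ) 1, 0 < E v := by
    intro v hv
    rcases le_total v θ with h1 | h1
    · have h2 : (∫ s in (0:ℝ)..v, f1 s) + E v = E 0 :=
        intervalIntegral.integral_add_adjacent_intervals (hf1c.intervalIntegrable _ _)
          (hf1c.intervalIntegrable _ _)
      have h3 : (∫ s in (0:ℝ)..v, f1 s) ≤ ∫ s in (0:ℝ)..v, (0:ℝ) := by
        refine intervalIntegral.integral_mono_on hv.1 (hf1c.intervalIntegrable _ _)
          (continuous_const.intervalIntegrable _ _) fun s hs => ?_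
        rw [hf1e s hs.1]
        exact hneg s ⟨hs.1, hs.2.trans h1⟩
      simp at h3
      linarith
    · refine intervalIntegral.intervalIntegral_pos_of_pos_on (hf1c.intervalIntegrable _ _)
        (fun s hs => ?_) hv.2
      rw [hf1e s (hv.1.trans hs.1.le)]
      exact hpos s ⟨lt_of_le_of_lt h1 hs.1, hs.2⟩
  -- behaviour near one
  have hnear : ∃ r, 0 < r ∧ r < 1 ∧ ∃ a, 0 < a ∧ ∀ v ∈ Ioo r 1, a * (1 - v) ≤ F v := by
    set b := derivWithin F (Ici 0) 1 with hb
    have hbd : HasDerivAt F b 1 := by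
      have h1 := (hreg.differentiableOn one_ne_zero 1 (by simp)).hasDerivWithinAt
      exact h1.hasDerivAt (Ici_mem_nhds one_pos)
    have h3 := (hasDerivAt_iff_tendsto_slope.1 hbd).mono_left
      (nhdsWithin_mono 1 (fun s (hs : s < 1) => ne_of_lt hs) : 𝓝[<] (1:ℝ) ≤ 𝓝[≠] 1)
    have h4 := h3.eventually (gt_mem_nhds (show b < b / 2 by linarith))
    obtain ⟨r, hr, hr2⟩ := (mem_nhdsLT_iff_exists_Ioo_subset' (show (1/2:ℝ) < 1 by norm_num)).1 h4
    refine ⟨max r (1 / 2), by positivity, max_lt hr (by norm_num), -b / 2, by linarith, ?_⟩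
    intro v hv
    have h5 : slope F 1 v < b / 2 := hr2 ⟨(le_max_left _ _).trans_lt hv.1, hv.2⟩
    rw [slope_def_field, hF1, sub_zero, div_lt_iff_of_neg (by linarith [hv.2])] at h5
    linarith
  obtain ⟨r, hr0, hr1, a, ha, har⟩ := hnear
  have hEm : ∃ m, 0 < m ∧ ∀ v ∈ Ico (0:ℝ) 1, m * (1 - v) ^ 2 ≤ E v := by
    obtain ⟨z, hz, hzmin⟩ := (isCompact_Icc (a := (0:ℝ)) (b := r)).exists_isMinOn
      ⟨0, le_rfl, hr0.le⟩ hEc.continuousOn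
    have hzp := hEpos z ⟨hz.1, hz.2.trans_lt hr1⟩
    refine ⟨min (E z) (a / 2), lt_min hzp (by positivity), fun v hv => ?_⟩
    rcases le_total v r with h1 | h1
    · have h2 : E z ≤ E v := hzmin ⟨hv.1, h1⟩
      have h3 : (1 - v) ^ 2 ≤ 1 := by nlinarith [hv.1, hv.2]
      have h4 := min_le_left (E z) (a / 2)
      have h5 : 0 < min (E z) (a / 2) := lt_min hzp (by positivity)
      nlinarith
    · have hdd : ∀ w, HasDerivAt (fun w => E w - a / 2 * (1 - w) ^ 2)
          (-f1 w - a / 2 * (2 * (1 - w) * (-1))) w := by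
        intro w
        have h5 : HasDerivAt (fun w : ℝ => (1 - w) ^ 2) (2 * (1 - w) * (-1)) w := by
          refine (((hasDerivAt_id w).const_sub 1).pow 2).congr_deriv ?_
          simp
        exact (hEd w).sub (h5.const_mul _)
      have hanti : AntitoneOn (fun w => E w - a / 2 * (1 - w) ^ 2) (Icc r 1) := by
        refine antitoneOn_of_deriv_nonpos (convex_Icc _ _)
          (fun w _ => (hdd w).continuousAt.continuousWithinAt)
          (fun w _ => (hdd w).differentiableAt.differentiableWithinAt) fun w hw => ?_
        rw [interior_Icc] at hw
        rw [(hdd w).deriv, hf1e w (hr0.le.trans hw.1.le)]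
        have := har w hw
        linarith
      have h6 := hanti ⟨h1, hv.2.le⟩ ⟨hr1.le, le_rfl⟩ hv.2.le
      simp [hE1] at h6
      have h4 := min_le_right (E z) (a / 2)
      have h7 := mul_le_mul_of_nonneg_right h4 (sq_nonneg (1 - v))
      linarith
  obtain ⟨m, hm, hmE⟩ := hEm
  have hEL : ∀ v ∈ Icc (0:ℝ) 1, E v ≤ L / 2 * (1 - v) ^ 2 := by
    intro v hv
    have hdd : ∀ w, HasDerivAt (fun w => E w - L / 2 * (1 - w) ^ 2)
        (-f1 w - L / 2 * (2 * (1 - w) * (-1))) w := by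
      intro w
      have h5 : HasDerivAt (fun w : ℝ => (1 - w) ^ 2) (2 * (1 - w) * (-1)) w := by
        refine (((hasDerivAt_id w).const_sub 1).pow 2).congr_deriv ?_
        simp
      exact (hEd w).sub (h5.const_mul _)
    have hmono : MonotoneOn (fun w => E w - L / 2 * (1 - w) ^ 2) (Icc 0 1) := by
      refine monotoneOn_of_deriv_nonneg (convex_Icc _ _)
        (fun w _ => (hdd w).continuousAt.continuousWithinAt)
        (fun w _ => (hdd w).differentiableAt.differentiableWithinAt) fun w hw => ?_
      rw [interior_Icc] at hw
      rw [(hdd w).deriv, hf1e w hw.1.le]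
      have := hFL w ⟨hw.1.le, hw.2.le⟩
      linarith
    have h6 := hmono hv ⟨zero_le_one, le_rfl⟩ hv.2
    simp [hE1] at h6
    linarith
  set P : ℝ → ℝ := fun v => E v - m / 2 * (1 - v) ^ 2 with hP
  have hPc : Continuous P := by simp only [hP]; fun_prop
  have hPd : ∀ v, HasDerivAt P (-f1 v + m * (1 - v)) v := by
    intro w
    have h5 : HasDerivAt (fun w : ℝ => (1 - w) ^ 2) (2 * (1 - w) * (-1)) w := by
      refine (((hasDerivAt_id w).const_sub 1).pow 2).congr_deriv ?_
      simp
    exact ((hEd w).sub (h5.const_mul (m / 2))).congr_deriv (by ring)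
  have hPpos : ∀ v ∈ Ico (0:ℝ) 1, 0 < P v := by
    intro v hv
    have h1 := hmE v hv
    have h2 : 0 < (1 - v) ^ 2 := by have : 0 < 1 - v := by linarith [hv.2]
                                    positivity
    simp only [hP]; nlinarith
  have hPle : ∀ v ∈ Ico (0:ℝ) 1, P v ≤ L / 2 * (1 - v) ^ 2 := by
    intro v hv
    have h1 := hEL v ⟨hv.1, hv.2.le⟩
    have h2 : 0 ≤ m / 2 * (1 - v) ^ 2 := by positivity
    simp only [hP]; linarith
  have hmax : ∀ v : ℝ, v < 1 → max v 0 ∈ Ico (0:ℝ) 1 := fun v hv =>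
    ⟨le_max_right _ _, max_lt hv one_pos⟩
  refine ⟨fun v => √(2 / d * P (max v 0)), fun v => (2 / d * (-f1 v + m * (1 - v))) /
    (2 * √(2 / d * P v)), √(L / d), m, by positivity, hm, by fun_prop, ?_, ?_, ?_⟩
  · intro v hv
    have := hPpos _ (hmax v hv)
    positivity
  · intro v hv
    have h1 := hPle _ (hmax v hv)
    have h2 := (hmax v hv).2
    have h3 : √(2 / d * P (max v 0)) ≤ √(L / d) * (1 - max v 0) := by
      rw [Real.sqrt_le_iff]
      refine ⟨mul_nonneg (Real.sqrt_nonneg _) (by linarith), ?_⟩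
      rw [mul_pow, Real.sq_sqrt (by positivity)]
      have h4 := mul_le_mul_of_nonneg_left h1 (show 0 ≤ 2 / d by positivity)
      refine h4.trans (le_of_eq ?_)
      field_simp
    refine h3.trans (mul_le_mul_of_nonneg_left ?_ (Real.sqrt_nonneg _))
    linarith [le_max_left v 0]
  · intro v hv
    have hPv := hPpos v ⟨hv.1.le, hv.2⟩
    have harg : 0 < 2 / d * P v := by positivity
    constructor
    · have h1 : HasDerivAt (fun v => √(2 / d * P v)) ((2 / d * (-f1 v + m * (1 - v))) /
        (2 * √(2 / d * P v))) v := ((hPd v).const_mul (2 / d)).sqrt harg.ne'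
      refine h1.congr_of_eventuallyEq ?_
      filter_upwards [Ioi_mem_nhds hv.1] with y hy
      rw [max_eq_left (le_of_lt hy)]
    · simp only
      rw [max_eq_left hv.1.le, hf1e v hv.1.le]
      have : 0 < √(2 / d * P v) := Real.sqrt_pos.2 harg
      field_simp

lemma aux_front (d L θ : ℝ) (F : ℝ → ℝ) (hd : 0 < d) (hF : AlleeType F θ) (hL : 0 < L)
    (hFL : ∀ v ∈ Icc (0:ℝ) 1, F v ≤ L * (1 - v)) :
    ∃ (q q' q'' : ℝ → ℝ) (c : ℝ), 0 < c ∧ q 0 = 0 ∧ Monotone q ∧ (∀ y, q y < 1) ∧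
      (∀ ε > 0, ∃ Y, 0 ≤ Y ∧ 1 - ε ≤ q Y) ∧ (∀ y, HasDerivAt q (q' y) y) ∧
      ∀ y, 0 < q y → HasDerivAt q' (q'' y) y ∧ c * q' y < d * q'' y + F (q y) := by
  obtain ⟨p, p', C, κ, hC, hκ, hpc, hpp, hpC, hp⟩ := aux_profile d L θ F hd hF hL hFL
  have hlt : ∀ y : ℝ, 1 - Real.exp (-y) < 1 := fun y => by linarith [Real.exp_pos (-y)]
  obtain ⟨r, hr, hr0, hrm, hrs⟩ := aux_ode (fun y => p (1 - Real.exp (-y)) * Real.exp y) C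
    (by fun_prop) (fun y => mul_pos (hpp _ (hlt y)) (Real.exp_pos _)) (fun y => by
      have h1 := mul_le_mul_of_nonneg_right (hpC _ (hlt y)) (Real.exp_pos y).le
      have h2 : Real.exp (-y) * Real.exp y = 1 := by rw [← Real.exp_add]; simp
      calc _ ≤ _ := h1
        _ = C * (Real.exp (-y) * Real.exp y) := by ring
        _ = C := by rw [h2, mul_one])
  have hqd : ∀ y, HasDerivAt (fun y => 1 - Real.exp (-r y)) (p (1 - Real.exp (-r y))) y := by
    intro y
    have h1 := ((hr y).neg.exp).const_sub 1
    refine h1.congr_deriv ?_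
    have h2 : Real.exp (-r y) * Real.exp (r y) = 1 := by rw [← Real.exp_add]; simp
    simp only [Pi.neg_apply]
    linear_combination (p (1 - Real.exp (-r y))) * h2
  refine ⟨fun y => 1 - Real.exp (-r y), fun y => p (1 - Real.exp (-r y)),
    fun y => p' (1 - Real.exp (-r y)) * p (1 - Real.exp (-r y)), κ / (2 * C), by positivity,
    by simp [hr0], ?_, fun y => hlt _, ?_, hqd, ?_⟩
  · intro a b hab
    have := Real.exp_le_exp.2 (neg_le_neg (hrm.monotone hab))
    simp only
    linarith
  · intro ε hε
    obtain ⟨Y, hY⟩ := hrs (max 0 (-Real.log ε))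
    refine ⟨Y, ?_, ?_⟩
    · rw [← hrm.le_iff_le, hr0, hY]; exact le_max_left _ _
    · have h1 : Real.exp (-r Y) ≤ ε := by
        rw [← Real.le_log_iff_exp_le hε |>.symm.symm]
        rw [hY]
        linarith [le_max_right 0 (-Real.log ε)]
      simp only
      linarith
  · intro y hy
    have h1 := hp (1 - Real.exp (-r y)) ⟨hy, hlt _⟩
    refine ⟨h1.1.comp y (hqd y), ?_⟩
    have h2 := hpC _ (hlt (r y))
    have h3 := mul_le_mul_of_nonneg_left h2 (show 0 ≤ κ / (2 * C) by positivity)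
    have h4 : κ / (2 * C) * (C * (1 - (1 - Real.exp (-r y)))) = κ / 2 * Real.exp (-r y) := by
      field_simp; ring
    have h5 := mul_pos hκ (Real.exp_pos (-r y))
    have h6 := h1.2
    nlinarith

section
variable {d h₀ : ℝ} {f : ℝ → ℝ → ℝ → ℝ} {u₀ : ℝ → ℝ} {u : ℝ → ℝ → ℝ} {g h : ℝ → ℝ}

lemma aux_liminf {fbar funder : ℝ → ℝ} {θ β : ℝ} (hd : 0 < d) (hh₀ : 0 < h₀)
    (hf : CondF4 f fbar funder θ β) (hu₀ : InX 1 h₀ u₀)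
    (hsol : ClassicalSolution d 1 h₀ f u₀ (Ici (0:ℝ)) u g h) (S R : ℝ) (hS : 0 < S) (hR : 0 < R)
    (hbd : ∀ t, S ≤ t → -R ≤ g t ∧ h t ≤ R) (ε : ℝ) (hε : 0 < ε) :
    ∃ T, 0 < T ∧ ∀ t, T ≤ t → ∀ x ∈ Icc (g t) (h t), 1 - ε < u t x := by
  have hpos := aux_pos hd hh₀ hf.1 hu₀ hsol
  obtain ⟨L, hL, hLip⟩ := hf.1.1.2.2.2.2 1 one_pos
  have hFL : ∀ v ∈ Icc (0:ℝ) 1, funder v ≤ L * (1 - v) := by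
    intro v hv
    have h1 := hf.2.2 0 (by simp) 0 v hv.1
    have h2 := hLip 0 (by simp) 0 v hv 1 ⟨zero_le_one, le_rfl⟩
    rw [hf.1.2.1 0 (by simp) 0, sub_zero, abs_sub_comm v 1,
      abs_of_nonneg (show 0 ≤ 1 - v by linarith [hv.2])] at h2
    linarith [le_abs_self (f 0 0 v)]
  obtain ⟨q, q', q'', c, hc, hq0, hqm, hq1, hqlim, hqd, hqq⟩ :=
    aux_front d L θ funder hd hf.2.1 hL hFL
  have hqc : Continuous q := continuous_iff_continuousAt.2 fun y => (hqd y).continuousAt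
  obtain ⟨Y, hY0, hY⟩ := hqlim ε hε
  set T := (2 * R + Y) / c with hT
  have hcT : c * T = 2 * R + Y := by rw [hT]; field_simp
  have hTp : 0 < T := by positivity
  refine ⟨S + T, by linarith, fun t ht x hx => ?_⟩
  have hbt := hbd t (by linarith)
  have := aux_compare hd hu₀ hsol 1 (t - T) t (by linarith)
    (fun s y => q (y - x + Y + c * (s - t))) (by fun_prop) ?_ ?_ ?_ t ⟨by linarith, le_rfl⟩ x hx
  · simp at this
    linarith
  · intro y hy
    have hb := hbd (t - T) (by linarith)
    have h1 := hpos (t - T) (by linarith) y hy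
    have h2 : q (y - x + Y + c * (t - T - t)) ≤ q 0 := by
      apply hqm
      have : c * (t - T - t) = -(c * T) := by ring
      rw [this, hcT]
      linarith [hy.2, hx.1, hb.2, hbt.1]
    rw [hq0] at h2
    linarith
  · intro s hs
    have h1 := hq1 (g s - x + Y + c * (s - t))
    have h2 := hq1 (h s - x + Y + c * (s - t))
    constructor <;> linarith
  · intro s hs y hy e
    have hsp : 0 ≤ s := by linarith [hs.1]
    have hup := hpos s hsp y ⟨hy.1.le, hy.2.le⟩
    have hk := hqq (y - x + Y + c * (s - t)) (by rw [← e]; exact hup)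
    have hlx : ∀ z, HasDerivAt (fun y => y - x + Y + c * (s - t)) 1 z := fun z =>
      (((hasDerivAt_id z).sub_const x).add_const Y).add_const _
    refine ⟨q' (y - x + Y + c * (s - t)) * (c * 1), q'' (y - x + Y + c * (s - t)) * 1,
      fun y => q' (y - x + Y + c * (s - t)) * 1, ?_, Eventually.of_forall fun z => ?_, ?_, ?_⟩
    · have h1 : HasDerivAt (fun s => y - x + Y + c * (s - t)) (c * 1) s :=
        (((hasDerivAt_id s).sub_const t).const_mul c).const_add _
      exact (hqd (y - x + Y + c * (s - t))).comp s h1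
    · exact (hqd (z - x + Y + c * (s - t))).comp z (hlx z)
    · exact (hk.1.comp y (hlx y)).mul_const 1 |>.congr_deriv (by ring)
    · have h2 := hf.2.2 s hsp y (u s y) hup.le
      have h3 := hk.2
      rw [← e] at h3
      linarith

end

/-- Theorem 3.3, convergence part of the transition case `δ = 1`. -/
theorem transition_delta_one (d h₀ θ β : ℝ) (f : ℝ → ℝ → ℝ → ℝ)
    (fbar funder u₀ : ℝ → ℝ) (u : ℝ → ℝ → ℝ) (g h : ℝ → ℝ)
    (hd : 0 < d) (hh₀ : 0 < h₀)
    (hf4 : CondF4 f fbar funder θ β)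
    (hu₀ : InX 1 h₀ u₀)
    (hsol : ClassicalSolution d 1 h₀ f u₀ (Ici (0:ℝ)) u g h) :
    (∃ ginf : ℝ, Tendsto g atTop (nhds ginf)) ∧
    (∃ hinf : ℝ, Tendsto h atTop (nhds hinf)) ∧
    ∀ ε > 0, ∃ T > 0, ∀ t ≥ T, ∀ x ∈ Icc (g t) (h t), |u t x - 1| < ε := by
  obtain ⟨⟨S, R, hS, hR, hbd⟩, hg, hh⟩ := aux_boundaries hd hf4.1 hu₀ hsol
  refine ⟨hg, hh, fun ε hε => ?_⟩
  obtain ⟨T1, hT1, h1⟩ := aux_limsup hd hf4.1 hu₀ hsol ε hε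
  obtain ⟨T2, hT2, h2⟩ := aux_liminf hd hh₀ hf4 hu₀ hsol S R hS hR hbd ε hε
  refine ⟨max T1 T2, lt_max_of_lt_left hT1, fun t ht x hx => ?_⟩
  have a1 := h1 t ((le_max_left _ _).trans ht) x hx
  have a2 := h2 t ((le_max_right _ _).trans ht) x hx
  rw [abs_lt]
  constructor <;> linarith
end

section
/- Theorem 3.3, nondegeneracy part. Assume condition (f4) holds with bounds f̄ and f̲, and δ = 1. Let (u,g,h) be a classical solution of the free boundary problem (c) with initial datum u₀ ∈ X(h₀) on [0,∞), and let g_∞ := lim_{t→∞} g(t) and h_∞ := lim_{t→∞} h(t) (these limits exist and are finite). Suppose moreover that either u₀ − 1 does not change sign on [−h₀,h₀] (i.e. u₀ ≥ 1 on [−h₀,h₀] or u₀ ≤ 1 on [−h₀,h₀]), or there exists ε > 0 such that ε·f̲(u) ≥ f̄(u) for all u ∈ [1, 1+ε]. Then h_∞ − g_∞ > 0. -/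
open Set Filter

open Set Filter Topology

lemma region_compact {T T' : ℝ} {g h : ℝ → ℝ} (hgc : ContinuousOn g (Icc T T'))
    (hhc : ContinuousOn h (Icc T T')) (hgh : ∀ t ∈ Icc T T', g t < h t) :
    IsCompact {p : ℝ × ℝ | p.1 ∈ Icc T T' ∧ p.2 ∈ Icc (g p.1) (h p.1)} := by
  have h1 : IsCompact (Icc T T' ×ˢ Icc (0:ℝ) 1) := isCompact_Icc.prod isCompact_Icc
  have hg' : ContinuousOn (fun p : ℝ × ℝ => g p.1) (Icc T T' ×ˢ Icc (0:ℝ) 1) :=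
    hgc.comp continuousOn_fst (fun p hp => hp.1)
  have hh' : ContinuousOn (fun p : ℝ × ℝ => h p.1) (Icc T T' ×ˢ Icc (0:ℝ) 1) :=
    hhc.comp continuousOn_fst (fun p hp => hp.1)
  have h2 : ContinuousOn (fun p : ℝ × ℝ => (p.1, g p.1 + p.2 * (h p.1 - g p.1)))
      (Icc T T' ×ˢ Icc (0:ℝ) 1) :=
    continuousOn_fst.prodMk (hg'.add (continuousOn_snd.mul (hh'.sub hg')))
  convert h1.image_of_continuousOn h2 using 1
  ext ⟨t, x⟩
  simp only [mem_ofPred_eq, mem_image, mem_prod, Prod.mk.injEq, Prod.exists]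
  constructor
  · rintro ⟨ht, hx⟩
    have := hgh t ht
    refine ⟨t, (x - g t) / (h t - g t), ⟨ht, ?_, ?_⟩, rfl, ?_⟩
    · exact div_nonneg (by linarith [hx.1]) (by linarith)
    · rw [div_le_one (by linarith)]; linarith [hx.2]
    · have : h t - g t ≠ 0 := by linarith
      field_simp; ring
  · rintro ⟨s, y, ⟨hs, hy⟩, rfl, rfl⟩
    have := hgh s hs
    exact ⟨hs, by nlinarith [hy.1], by nlinarith [hy.2]⟩

/-- Abstract minimum principle on a moving domain. -/
lemma min_princ {T T' : ℝ} {g h : ℝ → ℝ} (hgc : ContinuousOn g (Icc T T'))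
    (hhc : ContinuousOn h (Icc T T')) (hgh : ∀ t ∈ Icc T T', g t < h t) {z : ℝ → ℝ → ℝ}
    (hz : ContinuousOn (fun p : ℝ × ℝ => z p.1 p.2)
      {p : ℝ × ℝ | p.1 ∈ Icc T T' ∧ p.2 ∈ Icc (g p.1) (h p.1)})
    (hinit : ∀ x ∈ Icc (g T) (h T), 0 < z T x)
    (hbg : ∀ t ∈ Icc T T', 0 < z t (g t)) (hbh : ∀ t ∈ Icc T T', 0 < z t (h t))
    (hno : ∀ t ∈ Ioc T T', ∀ x ∈ Ioo (g t) (h t), z t x = 0 →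
      (∀ᶠ y in 𝓝 x, 0 ≤ z t y) → (∀ᶠ s in 𝓝[<] t, 0 ≤ z s x) → False) :
    ∀ t ∈ Icc T T', ∀ x ∈ Icc (g t) (h t), 0 < z t x := by
  by_contra! hcon
  obtain ⟨t1, ht1, x1, hx1, hz1⟩ := hcon
  set K := {p : ℝ × ℝ | p.1 ∈ Icc T T' ∧ p.2 ∈ Icc (g p.1) (h p.1)} with hK
  have hKc : IsCompact K := region_compact hgc hhc hgh
  have hSc : IsCompact (K ∩ (fun p : ℝ × ℝ => z p.1 p.2) ⁻¹' Iic 0) :=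
    hKc.of_isClosed_subset (hz.preimage_isClosed_of_isClosed hKc.isClosed isClosed_Iic)
      inter_subset_left
  obtain ⟨⟨t, x⟩, ⟨⟨ht, hx⟩, hzt⟩, hmin⟩ :=
    hSc.exists_isMinOn ⟨(t1, x1), ⟨ht1, hx1⟩, hz1⟩ continuousOn_fst
  simp only [mem_preimage, mem_Iic] at hzt ht hx
  have hpos : ∀ s ∈ Ico T t, ∀ y ∈ Icc (g s) (h s), 0 < z s y := by
    intro s hs y hy
    by_contra! hc
    have : t ≤ s := hmin (a := (s, y)) ⟨⟨⟨hs.1, hs.2.le.trans ht.2⟩, hy⟩, hc⟩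
    exact absurd hs.2 (not_lt.mpr this)
  have hTt : T < t := by
    rcases ht.1.eq_or_lt with rfl | h'
    · exact absurd (hinit x hx) (not_lt.mpr hzt)
    · exact h'
  have hxg : g t < x := by
    rcases hx.1.eq_or_lt with h' | h'
    · have := hbg t ht; rw [h'] at this; linarith
    · exact h'
  have hxh : x < h t := by
    rcases hx.2.eq_or_lt with h' | h'
    · have := hbh t ht; rw [← h'] at this; linarith
    · exact h'
  -- nearby times
  have hleft : 𝓝[<] t ≤ 𝓝[Icc T T'] t := by
    rw [← nhdsWithin_Ico_eq_nhdsLT hTt]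
    exact nhdsWithin_mono _ (fun s hs => ⟨hs.1, hs.2.le.trans ht.2⟩)
  have hev : ∀ y ∈ Ioo (g t) (h t), ∀ᶠ s in 𝓝[<] t, s ∈ Ico T t ∧ y ∈ Icc (g s) (h s) := by
    intro y hy
    have e1 : ∀ᶠ s in 𝓝[<] t, g s < y := (hgc t ht).mono_left hleft (Iio_mem_nhds hy.1)
    have e2 : ∀ᶠ s in 𝓝[<] t, y < h s := (hhc t ht).mono_left hleft (Ioi_mem_nhds hy.2)
    have e3 : ∀ᶠ s in 𝓝[<] t, s ∈ Ico T t := Ico_mem_nhdsLT hTt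
    filter_upwards [e1, e2, e3] with s h1 h2 h3 using ⟨h3, h1.le, h2.le⟩
  have hnn : ∀ y ∈ Ioo (g t) (h t), 0 ≤ z t y := by
    intro y hy
    have hc : Tendsto (fun s => z s y) (𝓝[<] t) (𝓝 (z t y)) := by
      have h1 := hz (t, y) ⟨ht, hy.1.le, hy.2.le⟩
      have h2 : Tendsto (fun s : ℝ => (s, y)) (𝓝[<] t) (𝓝[K] (t, y)) := by
        refine tendsto_nhdsWithin_iff.2 ⟨?_, ?_⟩
        · exact (Continuous.tendsto (by fun_prop) t).mono_left nhdsWithin_le_nhds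
        · filter_upwards [hev y hy] with s hs
          exact ⟨⟨hs.1.1, hs.1.2.le.trans ht.2⟩, hs.2⟩
      exact h1.tendsto.comp h2
    refine ge_of_tendsto hc ?_
    filter_upwards [hev y hy] with s hs using (hpos s hs.1 y hs.2).le
  refine hno t ⟨hTt, ht.2⟩ x ⟨hxg, hxh⟩ (le_antisymm hzt (hnn x ⟨hxg, hxh⟩)) ?_ ?_
  · filter_upwards [Ioo_mem_nhds hxg hxh] with y hy using hnn y hy
  · filter_upwards [hev x ⟨hxg, hxh⟩] with s hs using (hpos s hs.1 x hs.2).le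

lemma deriv_nonpos_of_left {φ : ℝ → ℝ} {t a : ℝ} (hφ : HasDerivAt φ a t) (h0 : φ t = 0)
    (hl : ∀ᶠ s in 𝓝[<] t, 0 ≤ φ s) : a ≤ 0 := by
  have h1 : Tendsto (slope φ t) (𝓝[<] t) (𝓝 a) :=
    (hasDerivAt_iff_tendsto_slope_left_right.1 hφ).1
  refine le_of_tendsto h1 ?_
  filter_upwards [hl, self_mem_nhdsWithin] with s hs hst
  rw [slope_def_field, h0, sub_zero]
  exact div_nonpos_of_nonneg_of_nonpos hs (by linarith [mem_Iio.1 hst])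

lemma second_deriv_nonneg {φ ψ : ℝ → ℝ} {x b : ℝ} (hφ : ∀ᶠ y in 𝓝 x, HasDerivAt φ (ψ y) y)
    (hψ : HasDerivAt ψ b x) (h0 : φ x = 0) (hl : ∀ᶠ y in 𝓝 x, 0 ≤ φ y) : 0 ≤ b := by
  by_contra! hb
  have hmin : IsLocalMin φ x := by
    filter_upwards [hl] with y hy; rw [h0]; exact hy
  have hψ0 : ψ x = 0 := hmin.hasDerivAt_eq_zero hφ.self_of_nhds
  set c := -b / 4 with hc
  have hF : ∀ᶠ y in 𝓝 x, HasDerivAt (fun y => φ y + c * (y - x) ^ 2)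
      (ψ y + c * (2 * (y - x))) y := by
    filter_upwards [hφ] with y hy
    refine hy.add ?_
    have := (((hasDerivAt_id y).sub_const x).pow 2).const_mul c
    simpa using this
  have hd1 : deriv (fun y => φ y + c * (y - x) ^ 2) =ᶠ[𝓝 x] fun y => ψ y + c * (2 * (y - x)) := by
    filter_upwards [hF] with y hy using hy.deriv
  have hd2 : HasDerivAt (fun y => ψ y + c * (2 * (y - x))) (b + c * 2) x := by
    refine hψ.add ?_
    have := (((hasDerivAt_id x).sub_const x).const_mul 2).const_mul c
    simpa using this
  have hmax := isLocalMax_of_deriv_deriv_neg (f := fun y => φ y + c * (y - x) ^ 2) (x₀ := x)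
    (by rw [hd1.deriv_eq, hd2.deriv]; linarith) (by rw [hd1.self_of_nhds]; simp [hψ0])
    hF.self_of_nhds.continuousAt
  have hcc : 0 < c := by linarith
  have hev := (hmax.and hl)
  obtain ⟨y, ⟨hy1, hy2⟩, hyx⟩ := ((hev.filter_mono nhdsWithin_le_nhds).and
    (self_mem_nhdsWithin (a := x) (s := {x}ᶜ))).exists
  simp only [h0, sub_self] at hy1
  have : 0 < (y - x) ^ 2 := by
    have : y - x ≠ 0 := sub_ne_zero.2 hyx
    positivity
  nlinarith

lemma comparison {d h₀ : ℝ} {f : ℝ → ℝ → ℝ → ℝ} {u₀ : ℝ → ℝ} {u : ℝ → ℝ → ℝ} {g h : ℝ → ℝ}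
    (hd : 0 < d) (hsol : ClassicalSolution d 1 h₀ f u₀ (Ici (0:ℝ)) u g h)
    (σ c0 c1 l k x0 T : ℝ) (hT : 0 ≤ T) (φ : ℝ → ℝ → ℝ)
    (hφ : φ = fun t x => c0 + c1 * Real.exp (-l * t) * (2 - k * (x - x0) ^ 2))
    (hinit : ∀ x ∈ Icc (g T) (h T), 0 < σ * (u T x - φ T x))
    (hbg : ∀ t > T, 0 < σ * (1 - φ t (g t))) (hbh : ∀ t > T, 0 < σ * (1 - φ t (h t)))
    (hno : ∀ t > T, ∀ x ∈ Ioo (g t) (h t), u t x = φ t x →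
      0 ≤ σ * (-l * c1 * Real.exp (-l * t) * (2 - k * (x - x0) ^ 2)
        + d * (c1 * Real.exp (-l * t) * (2 * k)) - f t x (u t x)) → False) (hσ : σ ≠ 0) :
    ∀ t ≥ T, ∀ x ∈ Icc (g t) (h t), 0 < σ * (u t x - φ t x) := by
  intro t ht
  have hsub : Icc T t ⊆ Ici 0 := fun s hs => hT.trans hs.1
  have hφc : Continuous (fun p : ℝ × ℝ => φ p.1 p.2) := by
    rw [hφ]; fun_prop
  refine min_princ (T := T) (T' := t) (z := fun t x => σ * (u t x - φ t x))
    (hsol.g_reg.continuousOn.mono hsub) (hsol.h_reg.continuousOn.mono hsub)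
    (fun s hs => hsol.g_lt_h s (hsub hs)) ?_ hinit ?_ ?_ ?_ t ⟨ht, le_rfl⟩
  · refine continuousOn_const.mul (ContinuousOn.sub ?_ hφc.continuousOn)
    exact hsol.u_cont.mono (fun p hp => ⟨hsub hp.1, hp.2⟩)
  · intro s hs
    rcases hs.1.eq_or_lt with rfl | h'
    · exact hinit _ ⟨le_rfl, (hsol.g_lt_h _ (hsub hs)).le⟩
    · rw [hsol.bc_g s (hsub hs) (hT.trans_lt h')]; exact hbg s h'
  · intro s hs
    rcases hs.1.eq_or_lt with rfl | h'
    · exact hinit _ ⟨(hsol.g_lt_h _ (hsub hs)).le, le_rfl⟩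
    · rw [hsol.bc_h s (hsub hs) (hT.trans_lt h')]; exact hbh s h'
  · intro s hs x hx hz hev1 hev2
    have hs0 : 0 < s := hT.trans_lt hs.1
    have hsI : s ∈ Ici (0:ℝ) := hs0.le
    have hux : u s x = φ s x := by
      rcases mul_eq_zero.1 hz with h' | h'
      · exact absurd h' hσ
      · linarith
    refine hno s hs.1 x hx hux ?_
    have ht1 := (hsol.ut_diff s hsI hs0 x hx).hasDerivAt
    have ht2 : HasDerivAt (fun s => φ s x)
        (-l * c1 * Real.exp (-l * s) * (2 - k * (x - x0) ^ 2)) s := by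
      rw [hφ]
      have h1 : HasDerivAt (fun s : ℝ => -l * s) (-l) s := by
        simpa using (hasDerivAt_id s).const_mul (-l)
      have := ((h1.exp.const_mul c1).mul_const (2 - k * (x - x0) ^ 2)).const_add c0
      exact this.congr_deriv (by ring)
    have hA := deriv_nonpos_of_left ((ht1.sub ht2).const_mul σ) hz hev2
    have hx1 : ∀ᶠ y in 𝓝 x, HasDerivAt (fun y => σ * (u s y - φ s y))
        (σ * (deriv (u s) y - c1 * Real.exp (-l * s) * (-(k * (2 * (y - x0)))))) y := by
      filter_upwards [Ioo_mem_nhds hx.1 hx.2] with y hy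
      refine ((hsol.ux_diff s hsI hs0 y ⟨hy.1.le, hy.2.le⟩).hasDerivAt.sub ?_).const_mul σ
      rw [hφ]
      have h1 : HasDerivAt (fun y : ℝ => (y - x0) ^ 2) (2 * (y - x0)) y := by
        have := ((hasDerivAt_id' y).sub_const x0).fun_pow 2
        simpa using this
      exact (((h1.const_mul k).const_sub 2).const_mul (c1 * Real.exp (-l * s))).const_add c0
    have hx2 : HasDerivAt (fun y => σ * (deriv (u s) y
        - c1 * Real.exp (-l * s) * (-(k * (2 * (y - x0))))))
        (σ * (deriv (deriv (u s)) x - c1 * Real.exp (-l * s) * (-(k * 2)))) x := by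
      refine ((hsol.uxx_diff s hsI hs0 x hx).hasDerivAt.sub ?_).const_mul σ
      have h1 : HasDerivAt (fun y : ℝ => 2 * (y - x0)) 2 x := by
        simpa using ((hasDerivAt_id x).sub_const x0).const_mul 2
      exact ((h1.const_mul k).neg).const_mul (c1 * Real.exp (-l * s))
    have hB := second_deriv_nonneg hx1 hx2 hz hev1
    have hp := hsol.pde s hsI hs0 x hx
    rw [hp] at hA
    nlinarith [mul_nonneg hd.le hB]

lemma pos_of_sol {d h₀ θ β : ℝ} {f : ℝ → ℝ → ℝ → ℝ} {fbar funder u₀ : ℝ → ℝ} {u : ℝ → ℝ → ℝ}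
    {g h : ℝ → ℝ} (hd : 0 < d) (hh₀ : 0 < h₀)
    (hf4 : CondF4 f fbar funder θ β) (hu₀ : InX 1 h₀ u₀)
    (hsol : ClassicalSolution d 1 h₀ f u₀ (Ici (0:ℝ)) u g h) :
    ∀ t ≥ 0, ∀ x ∈ Icc (g t) (h t), 0 < u t x := by
  obtain ⟨L, hL, hLip⟩ := hf4.1.1.2.2.2.2 1 one_pos
  have hz := hf4.1.1.2.2.2.1
  obtain ⟨xm, hxm, hm⟩ := (isCompact_Icc (a := -h₀) (b := h₀)).exists_isMinOn
    ⟨0, by constructor <;> linarith⟩ hu₀.1.continuousOn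
  have hmpos := hu₀.2.2.2 xm hxm
  have hm1 : u₀ xm ≤ 1 := by
    have := hm (right_mem_Icc.2 (by linarith) : h₀ ∈ Icc (-h₀) h₀)
    simp only [mem_ofPred_eq, hu₀.2.2.1] at this
    exact this
  set e := u₀ xm / 4 with he
  have key := comparison hd hsol 1 0 e (L + 1) 0 0 0 le_rfl _ rfl ?_ ?_ ?_ ?_ one_ne_zero
  · intro t ht x hx
    have := key t ht x hx
    have h2 := mul_pos (show 0 < e by positivity) (Real.exp_pos (-(L + 1) * t))
    simp only [zero_mul, sub_zero, zero_add, one_mul] at this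
    nlinarith
  · intro x hx
    rw [hsol.g_init, hsol.h_init] at hx
    rw [hsol.u_init x hx]
    have := hm hx
    simp only [mem_ofPred_eq] at this
    simp
    linarith
  · intro t ht
    have : Real.exp (-(L + 1) * t) ≤ 1 := Real.exp_le_one_iff.2 (by nlinarith)
    simp only [zero_mul, sub_zero, zero_add, one_mul]
    nlinarith
  · intro t ht
    have : Real.exp (-(L + 1) * t) ≤ 1 := Real.exp_le_one_iff.2 (by nlinarith)
    simp only [zero_mul, sub_zero, zero_add, one_mul]
    nlinarith
  · intro t ht x hx hux hc
    have h1 : Real.exp (-(L + 1) * t) ≤ 1 := Real.exp_le_one_iff.2 (by nlinarith)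
    have h2 := mul_pos (show 0 < e by positivity) (Real.exp_pos (-(L + 1) * t))
    simp only [zero_mul, sub_zero, zero_add, one_mul, mul_zero, add_zero] at hc hux
    have hu0 : 0 < u t x := by rw [hux]; linarith
    have hu1 : u t x ≤ 1 := by rw [hux]; nlinarith
    have := hLip t ht.le x (u t x) ⟨hu0.le, hu1⟩ 0 ⟨le_rfl, zero_le_one⟩
    rw [hz t ht.le x, sub_zero, sub_zero, abs_of_pos hu0] at this
    have := (abs_le.1 this).1
    nlinarith


set_option maxHeartbeats 1000000 in
lemma decay {d h₀ θ β x0 : ℝ} {f : ℝ → ℝ → ℝ → ℝ} {fbar funder u₀ : ℝ → ℝ} {u : ℝ → ℝ → ℝ}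
    {g h : ℝ → ℝ} (hd : 0 < d) (hh₀ : 0 < h₀)
    (hf4 : CondF4 f fbar funder θ β) (hu₀ : InX 1 h₀ u₀)
    (hsol : ClassicalSolution d 1 h₀ f u₀ (Ici (0:ℝ)) u g h)
    (hg : Tendsto g atTop (nhds x0)) (hh : Tendsto h atTop (nhds x0)) :
    ∃ A > 0, ∃ T ≥ 1, ∀ t ≥ T, ∀ x ∈ Icc (g t) (h t), |u t x - 1| ≤ A * Real.exp (-t) := by
  have hpos := pos_of_sol hd hh₀ hf4 hu₀ hsol
  obtain ⟨L, hL, hLip⟩ := hf4.1.1.2.2.2.2 1 one_pos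
  have hf1 := hf4.1.2.1
  have hfb := hf4.1.2.2.2
  set k := (L + 2) / d with hk
  have hk0 : 0 < k := by positivity
  have hdk : d * k = L + 2 := by rw [hk]; field_simp
  set r := 1 / (k + 1) with hr
  have hr0 : 0 < r := by positivity
  have hkr : k * r ^ 2 ≤ 1 := by
    rw [hr, div_pow, one_pow, mul_one_div, div_le_one (by positivity)]; nlinarith
  have e1 : ∀ᶠ t in atTop, x0 - r < g t := hg (Ioi_mem_nhds (by linarith))
  have e2 : ∀ᶠ t in atTop, h t < x0 + r := hh (Iio_mem_nhds (by linarith))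
  obtain ⟨T0, hT0⟩ := ((e1.and e2)).exists_forall_of_atTop
  set T := max T0 1 with hTdef
  have hT1 : 1 ≤ T := le_max_right _ _
  have hTT0 : T0 ≤ T := le_max_left _ _
  have hcc : ∀ t ≥ T, ∀ x ∈ Icc (g t) (h t), 1 ≤ 2 - k * (x - x0) ^ 2 ∧
      2 - k * (x - x0) ^ 2 ≤ 2 := by
    intro t ht x hx
    have := hT0 t (hTT0.trans ht)
    have h1 : (x - x0) ^ 2 ≤ r ^ 2 := by
      apply sq_le_sq'
      · linarith [hx.1]
      · linarith [hx.2]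
    constructor
    · nlinarith
    · nlinarith [sq_nonneg (x - x0)]
  have hTI : T ∈ Ici (0:ℝ) := by simp only [mem_Ici]; linarith
  have hcT : ContinuousOn (u T) (Icc (g T) (h T)) := by
    have : ContinuousOn (fun x : ℝ => (T, x)) (Icc (g T) (h T)) := by fun_prop
    exact hsol.u_cont.comp this (fun x hx => ⟨hTI, hx⟩)
  obtain ⟨B, hB⟩ := isCompact_Icc.exists_bound_of_continuousOn (hcT.sub (continuousOn_const (c := 1)))
  have hB0 : 0 ≤ B := (norm_nonneg _).trans (hB (g T) ⟨le_rfl, (hsol.g_lt_h T hTI).le⟩)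
  set A := (B + 1) * Real.exp T with hA
  have hA0 : 0 < A := by positivity
  have hAT : A * Real.exp (-1 * T) = B + 1 := by
    rw [hA, mul_assoc, ← Real.exp_add]; simp
  have hgI : ∀ t ≥ T, g t ∈ Icc (g t) (h t) := fun t ht =>
    ⟨le_rfl, (hsol.g_lt_h t (by simp only [mem_Ici]; linarith)).le⟩
  have hhI : ∀ t ≥ T, h t ∈ Icc (g t) (h t) := fun t ht =>
    ⟨(hsol.g_lt_h t (by simp only [mem_Ici]; linarith)).le, le_rfl⟩
  have hup := comparison hd hsol (-1) 1 A 1 k x0 T hTI _ rfl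
    (by
      intro x hx
      have h1 := hB x hx
      rw [Real.norm_eq_abs] at h1
      have h2 := (abs_le.1 h1).2
      have h3 := (hcc T le_rfl x hx).1
      simp only [hAT]
      simp only [Pi.sub_apply] at h2
      nlinarith)
    (by
      intro t ht
      have h3 := (hcc t ht.le _ (hgI t ht.le)).1
      have := mul_pos hA0 (Real.exp_pos (-1 * t))
      nlinarith)
    (by
      intro t ht
      have h3 := (hcc t ht.le _ (hhI t ht.le)).1
      have := mul_pos hA0 (Real.exp_pos (-1 * t))
      nlinarith)
    (by
      intro t ht x hx hux hc
      obtain ⟨h3, h4⟩ := (hcc t ht.le x ⟨hx.1.le, hx.2.le⟩)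
      have hp := mul_pos hA0 (Real.exp_pos (-1 * t))
      set E := A * Real.exp (-1 * t) with hE
      have hu1 : 1 < u t x := by rw [hux]; nlinarith
      obtain ⟨h5, h6⟩ := hfb t (by simp only [mem_Ici]; linarith) x (u t x) hu1
      have h7 : -1 * A * Real.exp (-1 * t) = - E := by rw [hE]; ring
      rw [h7] at hc
      have h8 : d * (E * (2 * k)) = 2 * E * (L + 2) := by rw [← hdk]; ring
      rw [h8] at hc
      nlinarith [mul_pos hp hL])
    (by norm_num)
  have hlow := comparison hd hsol 1 1 (-A) 1 k x0 T hTI _ rfl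
    (by
      intro x hx
      have h1 := hB x hx
      rw [Real.norm_eq_abs] at h1
      have h2 := (abs_le.1 h1).1
      have h3 := (hcc T le_rfl x hx).1
      simp only [neg_mul A, hAT]
      simp only [Pi.sub_apply] at h2
      nlinarith)
    (by
      intro t ht
      have h3 := (hcc t ht.le _ (hgI t ht.le)).1
      have := mul_pos hA0 (Real.exp_pos (-1 * t))
      nlinarith)
    (by
      intro t ht
      have h3 := (hcc t ht.le _ (hhI t ht.le)).1
      have := mul_pos hA0 (Real.exp_pos (-1 * t))
      nlinarith)
    (by
      intro t ht x hx hux hc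
      obtain ⟨h3, h4⟩ := (hcc t ht.le x ⟨hx.1.le, hx.2.le⟩)
      have hp := mul_pos hA0 (Real.exp_pos (-1 * t))
      have ht0 : t ∈ Ici (0:ℝ) := by simp only [mem_Ici]; linarith
      have hu0 := hpos t ht0 x ⟨hx.1.le, hx.2.le⟩
      simp only [neg_mul A] at hux hc
      set E := A * Real.exp (-1 * t) with hE
      have hu1 : u t x < 1 := by rw [hux]; nlinarith
      have h5 := hLip t ht0 x (u t x) ⟨hu0.le, hu1.le⟩ 1 ⟨zero_le_one, le_rfl⟩
      rw [hf1 t ht0 x, sub_zero, abs_sub_comm (u t x), abs_of_pos (by linarith : 0 < 1 - u t x)] at h5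
      have h6 := (abs_le.1 h5).1
      have h7 : -1 * -A * Real.exp (-1 * t) = E := by rw [hE]; ring
      rw [h7] at hc
      have h8 : d * (-E * (2 * k)) = -(2 * E * (L + 2)) := by rw [← hdk]; ring
      rw [h8] at hc
      have h9 : L * (1 - u t x) ≤ L * (2 * E) := by
        apply mul_le_mul_of_nonneg_left _ hL.le
        nlinarith
      nlinarith)
    (by norm_num)
  refine ⟨2 * A, by positivity, T, hT1, fun t ht x hx => ?_⟩
  have h1 := hup t ht x hx
  have h2 := hlow t ht x hx
  obtain ⟨h3, h4⟩ := (hcc t ht x hx)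
  have hp := mul_pos hA0 (Real.exp_pos (-1 * t))
  have h5 : Real.exp (-t) = Real.exp (-1 * t) := by simp
  rw [h5, abs_le]
  simp only [neg_mul A] at h1 h2
  constructor <;> nlinarith

open MeasureTheory in
lemma endpoint_deriv {u : ℝ → ℝ → ℝ} {U : Set (ℝ × ℝ)} (hU : IsOpen U)
    (hu : ContinuousOn (fun p : ℝ × ℝ => u p.1 p.2) U) {b : ℝ → ℝ} {t0 b' : ℝ}
    (hb : HasDerivAt b b' t0) (hmem : (t0, b t0) ∈ U) :
    HasDerivAt (fun t => ∫ x in b t0..b t, u t x) (u t0 (b t0) * b') t0 := by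
  rw [hasDerivAt_iff_isLittleO]
  have h1 : (fun t => u t0 (b t0) * (b t - b t0 - (t - t0) * b')) =o[𝓝 t0] fun t => t - t0 := by
    have := (hasDerivAt_iff_isLittleO.1 hb)
    simpa using this.const_mul_left (u t0 (b t0))
  have h2 : (fun t => ∫ x in b t0..b t, (u t x - u t0 (b t0))) =o[𝓝 t0] fun t => b t - b t0 := by
    rw [Asymptotics.isLittleO_iff]
    intro c hc
    have hcont := (hu.continuousAt (hU.mem_nhds hmem))
    have hev := (Metric.continuousAt_iff.1 hcont) c hc
    obtain ⟨δ, hδ, hd⟩ := hev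
    have hbc := Metric.continuousAt_iff.1 hb.continuousAt δ hδ
    obtain ⟨ρ, hρ, hbρ⟩ := hbc
    filter_upwards [Metric.ball_mem_nhds t0 (lt_min hρ hδ)] with t ht
    rw [Metric.mem_ball, lt_min_iff] at ht
    refine intervalIntegral.norm_integral_le_of_norm_le_const ?_
    intro x hx
    have hbt := hbρ ht.1
    rw [Real.dist_eq] at hbt
    have hx2 : dist x (b t0) < δ := by
      rw [Real.dist_eq]
      refine lt_of_le_of_lt ?_ hbt
      exact abs_sub_left_of_mem_uIcc (uIoc_subset_uIcc hx)
    have := hd (x := (t, x)) (by rw [Prod.dist_eq]; exact max_lt ht.2 hx2)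
    rw [dist_eq_norm] at this
    exact this.le
  have h3 : (fun t => b t - b t0) =O[𝓝 t0] fun t => t - t0 := hb.isBigO_sub
  refine ((h2.trans_isBigO h3).add h1).congr' ?_ EventuallyEq.rfl
  -- integrability near t0
  obtain ⟨δ, hδ, hball⟩ := Metric.isOpen_iff.1 hU _ hmem
  obtain ⟨ρ, hρ, hbρ⟩ := Metric.continuousAt_iff.1 hb.continuousAt δ hδ
  filter_upwards [Metric.ball_mem_nhds t0 (lt_min hρ hδ)] with t ht
  rw [Metric.mem_ball, lt_min_iff] at ht
  have hint : IntervalIntegrable (u t) volume (b t0) (b t) := by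
    apply ContinuousOn.intervalIntegrable
    have hm : ContinuousOn (fun x : ℝ => (t, x)) (uIcc (b t0) (b t)) := by fun_prop
    refine hu.comp hm (fun x hx => hball ?_)
    rw [Metric.mem_ball, Prod.dist_eq]
    refine max_lt ht.2 ?_
    have hbt := hbρ ht.1
    rw [Real.dist_eq] at hbt ⊢
    exact lt_of_le_of_lt (abs_sub_left_of_mem_uIcc hx) hbt
  rw [intervalIntegral.integral_sub hint (by simp)]
  simp
  ring

open MeasureTheory in
lemma leibniz {u ut : ℝ → ℝ → ℝ} {U : Set (ℝ × ℝ)} (hU : IsOpen U)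
    (hu : ContinuousOn (fun p : ℝ × ℝ => u p.1 p.2) U)
    (hut : ContinuousOn (fun p : ℝ × ℝ => ut p.1 p.2) U)
    (hder : ∀ t x, (t, x) ∈ U → HasDerivAt (fun s => u s x) (ut t x) t)
    {a b : ℝ → ℝ} {t0 a' b' : ℝ}
    (ha : HasDerivAt a a' t0) (hb : HasDerivAt b b' t0) (hab : a t0 ≤ b t0)
    (hseg : ∀ x ∈ Icc (a t0) (b t0), (t0, x) ∈ U) :
    HasDerivAt (fun t => ∫ x in a t..b t, u t x)
      ((∫ x in a t0..b t0, ut t0 x) + u t0 (b t0) * b' - u t0 (a t0) * a') t0 := by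
  have hcpt : IsCompact (({t0} : Set ℝ) ×ˢ Icc (a t0) (b t0)) := isCompact_singleton.prod isCompact_Icc
  obtain ⟨ρ, hρ, hsub⟩ := hcpt.exists_cthickening_subset_open hU (by
    rintro ⟨t, x⟩ ⟨ht, hx⟩
    rw [mem_singleton_iff] at ht
    simp only at ht hx
    rw [ht]
    exact hseg x hx)
  have hbox : ∀ t ∈ Icc (t0 - ρ) (t0 + ρ), ∀ x ∈ Icc (a t0 - ρ) (b t0 + ρ), (t, x) ∈ U := by
    intro t ht x hx
    apply hsub
    have h1 : ∃ y ∈ Icc (a t0) (b t0), |x - y| ≤ ρ := by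
      rcases lt_or_ge x (a t0) with h' | h'
      · exact ⟨a t0, ⟨le_rfl, hab⟩, by rw [abs_le]; constructor <;> linarith [hx.1]⟩
      · rcases lt_or_ge (b t0) x with h'' | h''
        · exact ⟨b t0, ⟨hab, le_rfl⟩, by rw [abs_le]; constructor <;> linarith [hx.2]⟩
        · exact ⟨x, ⟨h', h''⟩, by simp [hρ.le]⟩
    obtain ⟨y, hy, hxy⟩ := h1
    refine Metric.mem_cthickening_of_dist_le (t, x) (t0, y) ρ _ ⟨rfl, hy⟩ ?_
    rw [Prod.dist_eq]
    refine max_le ?_ ?_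
    · simp only [Real.dist_eq]; rw [abs_le]; constructor <;> linarith [ht.1, ht.2]
    · simp only [Real.dist_eq]; exact hxy
  have hmemt : ∀ᶠ t in 𝓝 t0, t ∈ Icc (t0 - ρ) (t0 + ρ) :=
    Icc_mem_nhds (by linarith) (by linarith)
  have hslice : ∀ t ∈ Icc (t0 - ρ) (t0 + ρ), ContinuousOn (u t) (Icc (a t0 - ρ) (b t0 + ρ)) := by
    intro t ht
    have hm : ContinuousOn (fun x : ℝ => (t, x)) (Icc (a t0 - ρ) (b t0 + ρ)) := by fun_prop
    exact hu.comp hm (fun x hx => hbox t ht x hx)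
  have hslice' : ContinuousOn (ut t0) (Icc (a t0 - ρ) (b t0 + ρ)) := by
    have hm : ContinuousOn (fun x : ℝ => (t0, x)) (Icc (a t0 - ρ) (b t0 + ρ)) := by fun_prop
    exact hut.comp hm (fun x hx => hbox t0 ⟨by linarith, by linarith⟩ x hx)
  have hii : ∀ t ∈ Icc (t0 - ρ) (t0 + ρ), ∀ p ∈ Icc (a t0 - ρ) (b t0 + ρ),
      ∀ q ∈ Icc (a t0 - ρ) (b t0 + ρ), IntervalIntegrable (u t) volume p q := by
    intro t ht p hp q hq
    exact ((hslice t ht).mono (uIcc_subset_Icc hp hq)).intervalIntegrable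
  have ha0 : a t0 ∈ Icc (a t0 - ρ) (b t0 + ρ) := ⟨by linarith, by linarith⟩
  have hb0 : b t0 ∈ Icc (a t0 - ρ) (b t0 + ρ) := ⟨by linarith, by linarith⟩
  have ht00 : t0 ∈ Icc (t0 - ρ) (t0 + ρ) := ⟨by linarith, by linarith⟩
  have hae : ∀ᶠ t in 𝓝 t0, a t ∈ Icc (a t0 - ρ) (b t0 + ρ) :=
    ha.continuousAt (Icc_mem_nhds (by linarith) (by linarith))
  have hbe : ∀ᶠ t in 𝓝 t0, b t ∈ Icc (a t0 - ρ) (b t0 + ρ) :=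
    hb.continuousAt (Icc_mem_nhds (by linarith) (by linarith))
  have hbc : IsCompact (Icc (t0 - ρ) (t0 + ρ) ×ˢ Icc (a t0) (b t0)) :=
    isCompact_Icc.prod isCompact_Icc
  obtain ⟨C, hC⟩ := hbc.exists_bound_of_continuousOn (hut.mono (by
    rintro ⟨t, x⟩ ⟨ht, hx⟩
    exact hbox t ht x ⟨by linarith [hx.1], by linarith [hx.2]⟩))
  have hmain : HasDerivAt (fun t => ∫ x in a t0..b t0, u t x) (∫ x in a t0..b t0, ut t0 x) t0 := by
    refine (intervalIntegral.hasDerivAt_integral_of_dominated_loc_of_deriv_le (bound := fun _ => C)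
      (s := Icc (t0 - ρ) (t0 + ρ)) hmemt ?_ (hii t0 ht00 _ ha0 _ hb0) ?_ ?_ (by simp) ?_).2
    · filter_upwards [hmemt] with t ht
      exact (hii t ht _ ha0 _ hb0).def'.aestronglyMeasurable
    · have : IntervalIntegrable (ut t0) volume (a t0) (b t0) :=
        (hslice'.mono (uIcc_subset_Icc ha0 hb0)).intervalIntegrable
      exact this.def'.aestronglyMeasurable
    · refine Eventually.of_forall (fun x hx t ht => ?_)
      rw [uIoc_of_le hab] at hx
      exact hC (t, x) ⟨ht, hx.1.le, hx.2⟩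
    · refine Eventually.of_forall (fun x hx t ht => ?_)
      rw [uIoc_of_le hab] at hx
      exact hder t x (hbox t ht x ⟨by linarith [hx.1], by linarith [hx.2]⟩)
  have hE1 := endpoint_deriv hU hu hb (hseg _ ⟨hab, le_rfl⟩)
  have hE2 := endpoint_deriv hU hu ha (hseg _ ⟨le_rfl, hab⟩)
  refine ((hmain.add hE1).sub hE2).congr_of_eventuallyEq ?_
  filter_upwards [hmemt, hae, hbe] with t ht hat hbt
  have i1 := intervalIntegral.integral_add_adjacent_intervals (hii t ht _ ha0 _ hb0) (hii t ht _ hb0 _ hbt)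
  have i2 := intervalIntegral.integral_add_adjacent_intervals (hii t ht _ ha0 _ hat) (hii t ht _ hat _ hbt)
  simp only [Pi.sub_apply, Pi.add_apply]
  linarith

open MeasureTheory in
lemma mass_deriv {d h₀ : ℝ} {f : ℝ → ℝ → ℝ → ℝ} {u₀ : ℝ → ℝ} {u : ℝ → ℝ → ℝ} {g h : ℝ → ℝ}
    (hsol : ClassicalSolution d 1 h₀ f u₀ (Ici (0:ℝ)) u g h)
    {τ η B : ℝ} (hτ : 0 < τ) (hη : 0 < η) (hη2 : 2 * η < h τ - g τ)
    (hu : ∀ x ∈ Icc (g τ) (h τ), 1 / 2 ≤ u τ x) (hB : 0 ≤ B)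
    (hf : ∀ x ∈ Icc (g τ) (h τ), |f τ x (u τ x)| ≤ B) :
    ∃ P', HasDerivAt (fun t => ∫ x in (g t + η)..(h t - η), u t x) P' τ ∧
      d * (deriv (u τ) (h τ - η) - deriv (u τ) (h τ) * u τ (h τ - η))
      - d * (deriv (u τ) (g τ + η) - deriv (u τ) (g τ) * u τ (g τ + η))
      - 2 * B * (∫ x in (g τ + η)..(h τ - η), u τ x) ≤ P' := by
  set U := {p : ℝ × ℝ | 0 < p.1 ∧ p.2 ∈ Ioo (g p.1) (h p.1)} with hUdef
  have hgc : ContinuousOn g (Ioi 0) := hsol.g_reg.continuousOn.mono Ioi_subset_Ici_self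
  have hhc : ContinuousOn h (Ioi 0) := hsol.h_reg.continuousOn.mono Ioi_subset_Ici_self
  have hU : IsOpen U := by
    rw [isOpen_iff_mem_nhds]
    rintro ⟨t, x⟩ ⟨ht, hx1, hx2⟩
    simp only at ht hx1 hx2
    have hgt : ContinuousAt (fun p : ℝ × ℝ => g p.1) (t, x) :=
      ContinuousAt.comp (f := Prod.fst) (hgc.continuousAt (Ioi_mem_nhds ht)) continuousAt_fst
    have hht : ContinuousAt (fun p : ℝ × ℝ => h p.1) (t, x) :=
      ContinuousAt.comp (f := Prod.fst) (hhc.continuousAt (Ioi_mem_nhds ht)) continuousAt_fst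
    have e1 := hgt.eventually_lt continuousAt_snd hx1
    have e2 := continuousAt_snd.eventually_lt hht hx2
    have e3 : ∀ᶠ p : ℝ × ℝ in 𝓝 (t, x), 0 < p.1 :=
      continuousAt_const.eventually_lt continuousAt_fst ht
    filter_upwards [e1, e2, e3] with p h1 h2 h3 using ⟨h3, h1, h2⟩
  have hτI : τ ∈ Ici (0:ℝ) := hτ.le
  have hgd : HasDerivAt g (deriv g τ) τ :=
    ((hsol.g_reg.differentiableOn one_ne_zero).differentiableAt (Ici_mem_nhds hτ)).hasDerivAt
  have hhd : HasDerivAt h (deriv h τ) τ :=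
    ((hsol.h_reg.differentiableOn one_ne_zero).differentiableAt (Ici_mem_nhds hτ)).hasDerivAt
  have hsub : Icc (g τ + η) (h τ - η) ⊆ Ioo (g τ) (h τ) := fun x hx =>
    ⟨by linarith [hx.1], by linarith [hx.2]⟩
  have hab : g τ + η ≤ h τ - η := by linarith
  have hL := leibniz (u := u) (ut := fun t x => deriv (fun s => u s x) t) hU
    (hsol.u_cont.mono (fun p hp => ⟨hp.1.le, hp.2.1.le, hp.2.2.le⟩))
    (hsol.ut_cont.mono (fun p hp => ⟨hp.1.le, hp.1, hp.2⟩))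
    (fun t x hp => (hsol.ut_diff t hp.1.le hp.1 x hp.2).hasDerivAt)
    (hgd.add_const η) (hhd.sub_const η) hab (fun x hx => ⟨hτ, hsub hx⟩)
  refine ⟨_, hL, ?_⟩
  have hpair : ContinuousOn (fun x : ℝ => (τ, x)) (Icc (g τ + η) (h τ - η)) := by fun_prop
  have cxx : ContinuousOn (fun x => deriv (deriv (u τ)) x) (Icc (g τ + η) (h τ - η)) :=
    hsol.uxx_cont.comp hpair (fun x hx => ⟨hτI, hτ, hsub hx⟩)
  have ct : ContinuousOn (fun x => deriv (fun s => u s x) τ) (Icc (g τ + η) (h τ - η)) :=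
    hsol.ut_cont.comp hpair (fun x hx => ⟨hτI, hτ, hsub hx⟩)
  have cu : ContinuousOn (fun x => u τ x) (Icc (g τ + η) (h τ - η)) :=
    hsol.u_cont.comp hpair (fun x hx => ⟨hτI, (hsub hx).1.le, (hsub hx).2.le⟩)
  rw [← uIcc_of_le hab] at cxx ct cu
  have ixx := cxx.intervalIntegrable (μ := volume)
  have it := ct.intervalIntegrable (μ := volume)
  have iu := cu.intervalIntegrable (μ := volume)
  have hftc : ∫ x in (g τ + η)..(h τ - η), deriv (deriv (u τ)) x
      = deriv (u τ) (h τ - η) - deriv (u τ) (g τ + η) := by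
    refine intervalIntegral.integral_eq_sub_of_hasDerivAt (fun x hx => ?_) ixx
    rw [uIcc_of_le hab] at hx
    exact (hsol.uxx_diff τ hτI hτ x (hsub hx)).hasDerivAt
  have hmono : ∫ x in (g τ + η)..(h τ - η), (d * deriv (deriv (u τ)) x - 2 * B * u τ x)
      ≤ ∫ x in (g τ + η)..(h τ - η), deriv (fun s => u s x) τ := by
    refine intervalIntegral.integral_mono_on hab ((ixx.const_mul d).sub (iu.const_mul (2 * B))) it ?_
    intro x hx
    have hx' := hsub hx
    have hx'' : x ∈ Icc (g τ) (h τ) := ⟨hx'.1.le, hx'.2.le⟩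
    rw [hsol.pde τ hτI hτ x hx']
    have h1 := (abs_le.1 (hf x hx'')).1
    have h2 := hu x hx''
    nlinarith
  rw [intervalIntegral.integral_sub (ixx.const_mul d) (iu.const_mul (2 * B)),
    intervalIntegral.integral_const_mul, intervalIntegral.integral_const_mul, hftc] at hmono
  have hsg := hsol.stefan_g τ hτI hτ
  have hsh := hsol.stefan_h τ hτI hτ
  rw [div_one] at hsg hsh
  rw [hsg, hsh]
  linarith

set_option maxHeartbeats 2000000 in
open MeasureTheory in
lemma mass_ineq {d h₀ : ℝ} {f : ℝ → ℝ → ℝ → ℝ} {u₀ : ℝ → ℝ} {u : ℝ → ℝ → ℝ} {g h : ℝ → ℝ}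
    (hd : 0 < d) (hsol : ClassicalSolution d 1 h₀ f u₀ (Ici (0:ℝ)) u g h)
    {s t C : ℝ} (hC : 0 ≤ C) (hs : 0 < s) (hst : s < t)
    (hu : ∀ τ ∈ Icc s t, ∀ x ∈ Icc (g τ) (h τ), 1 / 2 ≤ u τ x ∧ u τ x ≤ 3 / 2)
    (hf : ∀ τ ∈ Icc s t, ∀ x ∈ Icc (g τ) (h τ), |f τ x (u τ x)| ≤ C * Real.exp (-τ)) :
    Real.exp (-(2 * C)) * ((h s - g s) / 2) ≤ 3 / 2 * (h t - g t) := by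
  have hsub : Icc s t ⊆ Ici 0 := fun τ hτ => hs.le.trans hτ.1
  have hgc : ContinuousOn g (Icc s t) := hsol.g_reg.continuousOn.mono hsub
  have hhc : ContinuousOn h (Icc s t) := hsol.h_reg.continuousOn.mono hsub
  have hgh : ∀ τ ∈ Icc s t, g τ < h τ := fun τ hτ => hsol.g_lt_h τ (hsub hτ)
  set K := {p : ℝ × ℝ | p.1 ∈ Icc s t ∧ p.2 ∈ Icc (g p.1) (h p.1)} with hK
  have hKc : IsCompact K := region_compact hgc hhc hgh
  have cu : ContinuousOn (fun p : ℝ × ℝ => u p.1 p.2) K :=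
    hsol.u_cont.mono (fun p hp => ⟨hsub hp.1, hp.2⟩)
  have cx : ContinuousOn (fun p : ℝ × ℝ => deriv (u p.1) p.2) K :=
    hsol.ux_cont.mono (fun p hp => ⟨hsub hp.1, hs.trans_le hp.1.1, hp.2⟩)
  obtain ⟨D, hD⟩ := hKc.exists_bound_of_continuousOn cx
  have hsI : s ∈ Icc s t := ⟨le_rfl, hst.le⟩
  have htI : t ∈ Icc s t := ⟨hst.le, le_rfl⟩
  have hD0 : 0 ≤ D := (norm_nonneg _).trans (hD (s, g s) ⟨hsI, le_rfl, (hgh s hsI).le⟩)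
  obtain ⟨tm, htm, hm⟩ := (isCompact_Icc (a := s) (b := t)).exists_isMinOn
    ⟨s, hsI⟩ (hhc.sub hgc)
  have hm0 : 0 < h tm - g tm := by linarith [hgh tm htm]
  have uu := Metric.uniformContinuousOn_iff.1 (hKc.uniformContinuousOn_of_continuous cu)
  have ux := Metric.uniformContinuousOn_iff.1 (hKc.uniformContinuousOn_of_continuous cx)
  refine le_of_forall_pos_le_add (fun ε hε => ?_)
  set R := 2 * d * (1 + D) * (t - s) + 1 with hR
  have hst' : 0 < t - s := by linarith
  have hR0 : 0 < R := by positivity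
  set e := ε / (2 * R) with he
  have he0 : 0 < e := by positivity
  obtain ⟨δ1, hδ1, H1⟩ := uu e he0
  obtain ⟨δ2, hδ2, H2⟩ := ux e he0
  obtain ⟨η, hη0, hη⟩ := exists_between
    (show (0:ℝ) < min (min δ1 δ2) (min ((h tm - g tm) / 4) (ε / 2)) from
      lt_min (lt_min hδ1 hδ2) (lt_min (by linarith) (by linarith)))
  rw [lt_min_iff, lt_min_iff, lt_min_iff] at hη
  obtain ⟨⟨hη1, hη2⟩, hη3, hη4⟩ := hη
  have hlen : ∀ τ ∈ Icc s t, 4 * η < h τ - g τ := by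
    intro τ hτ
    have := hm hτ
    simp only [Pi.sub_apply, mem_ofPred_eq] at this
    linarith
  set P : ℝ → ℝ := fun τ => ∫ x in (g τ + η)..(h τ - η), u τ x with hP
  have hder : ∀ τ ∈ Icc s t, ∃ P', HasDerivAt P P' τ ∧
      -(2 * d * (1 + D) * e) - 2 * (C * Real.exp (-τ)) * P τ ≤ P' := by
    intro τ hτ
    have hl := hlen τ hτ
    have hτ0 : 0 < τ := hs.trans_le hτ.1
    obtain ⟨P', h1, h2⟩ := mass_deriv hsol (τ := τ) (η := η) (B := C * Real.exp (-τ))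
      hτ0 hη0 (by linarith) (fun x hx => (hu τ hτ x hx).1) (by positivity) (hf τ hτ)
    refine ⟨P', h1, ?_⟩
    have mg : (τ, g τ) ∈ K := ⟨hτ, le_rfl, (hgh τ hτ).le⟩
    have mh : (τ, h τ) ∈ K := ⟨hτ, (hgh τ hτ).le, le_rfl⟩
    have mgη : (τ, g τ + η) ∈ K := ⟨hτ, by simp only; linarith, by simp only; linarith⟩
    have mhη : (τ, h τ - η) ∈ K := ⟨hτ, by simp only; linarith, by simp only; linarith⟩
    have dg : dist (τ, g τ + η) (τ, g τ) = η := by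
      rw [Prod.dist_eq, dist_self, Real.dist_eq]; simp [abs_of_pos hη0, hη0.le]
    have dh : dist (τ, h τ - η) (τ, h τ) = η := by
      rw [Prod.dist_eq, dist_self, Real.dist_eq]; simp [abs_of_pos hη0, hη0.le]
    have a1 := H1 _ mgη _ mg (by rw [dg]; exact hη1)
    have a2 := H1 _ mhη _ mh (by rw [dh]; exact hη1)
    have a3 := H2 _ mgη _ mg (by rw [dg]; exact hη2)
    have a4 := H2 _ mhη _ mh (by rw [dh]; exact hη2)
    have b1 := hD _ mg
    have b2 := hD _ mh
    simp only [Real.dist_eq, Real.norm_eq_abs] at a1 a2 a3 a4 b1 b2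
    rw [hsol.bc_g τ hτ0.le hτ0] at a1
    rw [hsol.bc_h τ hτ0.le hτ0] at a2
    have c1 : |deriv (u τ) (g τ) * (u τ (g τ + η) - 1)| ≤ D * e := by
      rw [abs_mul]; exact mul_le_mul b1 a1.le (abs_nonneg _) hD0
    have c2 : |deriv (u τ) (h τ) * (u τ (h τ - η) - 1)| ≤ D * e := by
      rw [abs_mul]; exact mul_le_mul b2 a2.le (abs_nonneg _) hD0
    have d1 := (abs_le.1 c1).1
    have d2 := (abs_le.1 c2).2
    have d3 := (abs_le.1 a3.le).2
    have d4 := (abs_le.1 a4.le).1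
    have key : -(2 * (1 + D) * e) ≤
        (deriv (u τ) (h τ - η) - deriv (u τ) (h τ) * u τ (h τ - η))
        - (deriv (u τ) (g τ + η) - deriv (u τ) (g τ) * u τ (g τ + η)) := by
      nlinarith
    have key2 := mul_le_mul_of_nonneg_left key hd.le
    change -(2 * d * (1 + D) * e) - 2 * (C * Real.exp (-τ)) *
      (∫ x in (g τ + η)..(h τ - η), u τ x) ≤ P'
    nlinarith
  have hint : ∀ τ ∈ Icc s t, IntervalIntegrable (u τ) volume (g τ + η) (h τ - η) := by
    intro τ hτ
    have hl := hlen τ hτ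
    apply ContinuousOn.intervalIntegrable
    rw [uIcc_of_le (by linarith)]
    have hpair : ContinuousOn (fun x : ℝ => (τ, x)) (Icc (g τ + η) (h τ - η)) := by fun_prop
    exact cu.comp hpair (fun x hx => ⟨hτ, by simp only; linarith [hx.1], by simp only; linarith [hx.2]⟩)
  have hPlow : (h s - g s - 2 * η) * (1 / 2) ≤ P s := by
    have hl := hlen s hsI
    have := intervalIntegral.integral_mono_on (a := g s + η) (b := h s - η) (by linarith)
      (intervalIntegrable_const (c := (1/2 : ℝ)) (μ := volume)) (hint s hsI)
      (fun x hx => (hu s hsI x ⟨by linarith [hx.1], by linarith [hx.2]⟩).1)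
    rw [intervalIntegral.integral_const, smul_eq_mul] at this
    refine le_trans (le_of_eq ?_) this
    ring
  have hPup : P t ≤ (h t - g t - 2 * η) * (3 / 2) := by
    have hl := hlen t htI
    have := intervalIntegral.integral_mono_on (a := g t + η) (b := h t - η) (by linarith)
      (hint t htI) (intervalIntegrable_const (c := (3/2 : ℝ)) (μ := volume))
      (fun x hx => (hu t htI x ⟨by linarith [hx.1], by linarith [hx.2]⟩).2)
    rw [intervalIntegral.integral_const, smul_eq_mul] at this
    refine le_trans this (le_of_eq ?_)
    ring
  set W : ℝ → ℝ := fun τ => Real.exp (-(2 * C * Real.exp (-τ))) with hW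
  have hW1 : ∀ τ, W τ ≤ 1 := fun τ => Real.exp_le_one_iff.2 (by
    have := Real.exp_pos (-τ)
    have : 0 ≤ 2 * C * Real.exp (-τ) := by positivity
    linarith)
  have hW0 : ∀ τ, 0 < W τ := fun τ => Real.exp_pos _
  have hWd : ∀ τ, HasDerivAt W (W τ * (2 * C * Real.exp (-τ))) τ := by
    intro τ
    have h1 : HasDerivAt (fun τ : ℝ => Real.exp (-τ)) (Real.exp (-τ) * (-1)) τ :=
      (hasDerivAt_neg τ).exp
    have h2 := ((h1.const_mul (2 * C)).fun_neg).exp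
    exact h2.congr_deriv (by simp only [hW]; ring)
  choose! P' hP'1 hP'2 using hder
  have hQd : ∀ τ ∈ Icc s t, HasDerivAt (fun τ => P τ * W τ)
      (P' τ * W τ + P τ * (W τ * (2 * C * Real.exp (-τ)))) τ :=
    fun τ hτ => (hP'1 τ hτ).mul (hWd τ)
  have hmvt := (convex_Icc s t).mul_sub_le_image_sub_of_le_deriv (f := fun τ => P τ * W τ)
    (C := -(2 * d * (1 + D) * e))
    (fun τ hτ => (hQd τ hτ).continuousAt.continuousWithinAt)
    (fun τ hτ => (hQd τ (interior_subset hτ)).differentiableAt.differentiableWithinAt)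
    (fun τ hτ => by
      have hτ' := interior_subset hτ
      rw [(hQd τ hτ').deriv]
      have h1 := mul_le_mul_of_nonneg_right (hP'2 τ hτ') (hW0 τ).le
      have h2 : 0 ≤ 2 * d * (1 + D) * e := by positivity
      nlinarith [mul_le_mul_of_nonneg_left (hW1 τ) h2])
    s hsI t htI hst.le
  have hWs : Real.exp (-(2 * C)) ≤ W s := by
    apply Real.exp_le_exp.2
    have : Real.exp (-s) ≤ 1 := Real.exp_le_one_iff.2 (by linarith)
    nlinarith
  have hls := hlen s hsI
  have hlt := hlen t htI
  have hPs0 : 0 ≤ (h s - g s - 2 * η) * (1 / 2) := by linarith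
  have i1 : Real.exp (-(2 * C)) * ((h s - g s - 2 * η) * (1 / 2)) ≤ P s * W s := by
    rw [mul_comm (P s)]
    exact mul_le_mul hWs hPlow hPs0 (hW0 s).le
  have i2 : P t * W t ≤ (h t - g t - 2 * η) * (3 / 2) := by
    have : 0 ≤ (h t - g t - 2 * η) * (3 / 2) := by linarith
    nlinarith [hW1 t, hW0 t]
  have i3 : 2 * d * (1 + D) * e * (t - s) ≤ ε / 2 := by
    have h1 : R * e = ε / 2 := by rw [he]; field_simp
    have h2 : 2 * d * (1 + D) * e * (t - s) = (R - 1) * e := by rw [hR]; ring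
    rw [h2]; linarith
  have i4 : Real.exp (-(2 * C)) ≤ 1 := Real.exp_le_one_iff.2 (by linarith)
  have i5 : Real.exp (-(2 * C)) * η ≤ η := by nlinarith
  nlinarith


/-- Theorem 3.3, nondegeneracy of the limit range when `δ = 1`. -/
theorem transition_nondegenerate (d h₀ θ β ginf hinf : ℝ) (f : ℝ → ℝ → ℝ → ℝ)
    (fbar funder u₀ : ℝ → ℝ) (u : ℝ → ℝ → ℝ) (g h : ℝ → ℝ)
    (hd : 0 < d) (hh₀ : 0 < h₀)
    (hf4 : CondF4 f fbar funder θ β)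
    (hu₀ : InX 1 h₀ u₀)
    (hsol : ClassicalSolution d 1 h₀ f u₀ (Ici (0:ℝ)) u g h)
    (hg : Tendsto g atTop (nhds ginf)) (hh : Tendsto h atTop (nhds hinf))
    (hsign : (∀ x ∈ Icc (-h₀) h₀, 1 ≤ u₀ x) ∨ (∀ x ∈ Icc (-h₀) h₀, u₀ x ≤ 1) ∨
      ∃ ε > 0, ∀ v ∈ Icc (1:ℝ) (1 + ε), fbar v ≤ ε * funder v) :
    0 < hinf - ginf := by
  by_contra hcon
  have hle : ginf ≤ hinf := le_of_tendsto_of_tendsto hg hh (by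
    filter_upwards [eventually_ge_atTop (0:ℝ)] with t ht using (hsol.g_lt_h t ht).le)
  have heq : hinf = ginf := by linarith
  subst heq
  obtain ⟨A, hA, T, hT, hdec⟩ := decay hd hh₀ hf4 hu₀ hsol hg hh
  obtain ⟨L, hL, hLip⟩ := hf4.1.1.2.2.2.2 2 two_pos
  have hf1 := hf4.1.2.1
  have hexp : Tendsto (fun t : ℝ => A * Real.exp (-t)) atTop (nhds 0) := by
    simpa using (Real.tendsto_exp_neg_atTop_nhds_zero.const_mul A)
  obtain ⟨T0, hT0⟩ := (hexp.eventually_lt_const (show (0:ℝ) < 1 / 2 by norm_num)).exists_forall_of_atTop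
  set s := max T T0 with hs
  have hsT : T ≤ s := le_max_left _ _
  have hsT0 : T0 ≤ s := le_max_right _ _
  have hbd : ∀ τ ≥ s, ∀ x ∈ Icc (g τ) (h τ), 1 / 2 ≤ u τ x ∧ u τ x ≤ 3 / 2 := by
    intro τ hτ x hx
    have h1 := hdec τ (hsT.trans hτ) x hx
    have h2 : A * Real.exp (-τ) < 1 / 2 := hT0 τ (hsT0.trans hτ)
    have h3 := abs_le.1 h1
    exact ⟨by linarith [h3.1], by linarith [h3.2]⟩
  have hfb : ∀ τ ≥ s, ∀ x ∈ Icc (g τ) (h τ), |f τ x (u τ x)| ≤ L * A * Real.exp (-τ) := by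
    intro τ hτ x hx
    have hτ0 : τ ∈ Ici (0:ℝ) := by simp only [mem_Ici]; linarith
    have h1 := hbd τ hτ x hx
    have h2 := hLip τ hτ0 x (u τ x) ⟨by linarith [h1.1], by linarith [h1.2]⟩ 1
      ⟨zero_le_one, one_le_two⟩
    rw [hf1 τ hτ0 x, sub_zero] at h2
    rw [mul_assoc]
    exact h2.trans (mul_le_mul_of_nonneg_left (hdec τ (hsT.trans hτ) x hx) hL.le)
  have hs0 : 0 < s := by linarith
  have hlim : Tendsto (fun t => 3 / 2 * (h t - g t)) atTop (nhds 0) := by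
    simpa using (hh.sub hg).const_mul (3 / 2)
  have hge : Real.exp (-(2 * (L * A))) * ((h s - g s) / 2) ≤ 0 := by
    refine ge_of_tendsto hlim ?_
    filter_upwards [eventually_gt_atTop s] with t ht
    exact mass_ineq hd hsol (by positivity) hs0 ht
      (fun τ hτ => hbd τ hτ.1) (fun τ hτ => hfb τ hτ.1)
  have h1 := hsol.g_lt_h s hs0.le
  have h2 := mul_pos (Real.exp_pos (-(2 * (L * A)))) (show 0 < (h s - g s) / 2 by linarith)
  linarith
end
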